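/- For the minimax control model: (i) the set Ŝ_M is analytic, and it is Borel if Γ_1 and Γ_2 are Borel; (ii) under Assumption AC, if p = ρ_x[π_1, π_2] for some x ∈ 𝕏 and (π_1, π_2) ∈ Π_1 × Π_2, then the section Ŝ_M(x, p) equals { ρ_x[π_1, π̃_2] : π̃_2 ∈ Π_2 }. -/

import Mathlib

open MeasureTheory ProbabilityTheory Filter
open scoped ENNReal NNReal Topology

noncomputable section

namespace PaperStmt

/-- The Borel σ-algebra of the topology of weak convergence on the space of Borel
probability measures. -/
instance instMeasProb {Ω : Type*} [MeasurableSpace Ω] [TopologicalSpace Ω]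
    [OpensMeasurableSpace Ω] : MeasurableSpace (ProbabilityMeasure Ω) := borel _


/-- Helper instance: the product topology on `P(Ω) × P(Ω)`. -/
instance instTopPMProd {α : Type*} [MeasurableSpace α] [TopologicalSpace α]
    [OpensMeasurableSpace α] :
    TopologicalSpace (ProbabilityMeasure α × ProbabilityMeasure α) :=
  @instTopologicalSpaceProd _ _ inferInstance inferInstance

/-- Helper instance: the product σ-algebra on `P(Ω) × P(Ω)`. -/
instance instMeasPMProd {α : Type*} [MeasurableSpace α] [TopologicalSpace α]
    [OpensMeasurableSpace α] :
    MeasurableSpace (ProbabilityMeasure α × ProbabilityMeasure α) :=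
  @Prod.instMeasurableSpace _ _ inferInstance inferInstance

/-- A set is universally measurable if it is measurable with respect to the completion of
every Borel probability measure. -/
def UniversallyMeasurableSet {α : Type*} [MeasurableSpace α] (s : Set α) : Prop :=
  ∀ μ : Measure α, IsProbabilityMeasure μ → NullMeasurableSet s μ

/-- A map between measurable spaces is universally measurable if preimages of measurable
sets are universally measurable. -/
def UniversallyMeasurable {α β : Type*} [MeasurableSpace α] [MeasurableSpace β]
    (f : α → β) : Prop :=
  ∀ s : Set β, MeasurableSet s → UniversallyMeasurableSet (f ⁻¹' s)

/-- Upper semianalytic functions on a topological (Borel) space. -/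
def UpperSemianalytic {γ : Type*} [TopologicalSpace γ] (f : γ → EReal) : Prop :=
  ∀ r : ℝ, MeasureTheory.AnalyticSet {x | (r : EReal) ≤ f x}

/-- The sample space `Ω = (𝕏 × 𝔸₁ × 𝔸₂)^∞` of the minimax control model. -/
abbrev TrajM (X A1 A2 : Type*) := ℕ → X × A1 × A2

/-- Histories `h_n = (x_0, a_0, …, x_n)` of the minimax model. -/
abbrev HistM (X A1 A2 : Type*) (n : ℕ) := (Fin n → X × A1 × A2) × X

/-- Controller information vectors `i_n = (x_0, a¹_0, x_1, …, x_n)`. -/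
abbrev InfoM (X A1 : Type*) (n : ℕ) := (Fin n → X × A1) × X

/-- The controller information vector determined by a history. -/
def infoM {X A1 A2 : Type*} : ∀ {n : ℕ}, HistM X A1 A2 n → InfoM X A1 n :=
  fun {_} h => (fun k => ((h.1 k).1, (h.1 k).2.1), h.2)

/-- The controller information vector determined by a trajectory, up to time `n`. -/
def iProjM {X A1 A2 : Type*} (n : ℕ) (ω : TrajM X A1 A2) : InfoM X A1 n :=
  (fun k : Fin n => ((ω k.val).1, (ω k.val).2.1), (ω n).1)

/-- A universally measurable policy for player 1 (the controller), who observes only the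
information vectors `i_n`. -/
structure Policy1 {X A1 : Type*} [MeasurableSpace X] [MeasurableSpace A1]
    (Acts1 : X → Set A1) where
  μ : ∀ n : ℕ, InfoM X A1 n → Measure A1
  isProb : ∀ n i, IsProbabilityMeasure (μ n i)
  umeas : ∀ (n : ℕ) (B : Set A1), MeasurableSet B →
    UniversallyMeasurable fun i : InfoM X A1 n => μ n i B
  feasible : ∀ n i, μ n i (Acts1 i.2) = 1

/-- A universally measurable policy for player 2 (the opponent), who observes the full
histories `h_n`. -/
structure Policy2 (A1 : Type*) {X A2 : Type*} [MeasurableSpace X] [MeasurableSpace A1]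
    [MeasurableSpace A2] (Acts2 : X → Set A2) where
  μ : ∀ n : ℕ, HistM X A1 A2 n → Measure A2
  isProb : ∀ n h, IsProbabilityMeasure (μ n h)
  umeas : ∀ (n : ℕ) (B : Set A2), MeasurableSet B →
    UniversallyMeasurable fun h : HistM X A1 A2 n => μ n h B
  feasible : ∀ n h, μ n h (Acts2 h.2) = 1

variable {X A1 A2 : Type*} [MeasurableSpace X] [MeasurableSpace A1] [MeasurableSpace A2]

/-- The iterated integral giving the finite-dimensional distributions of the minimax
control model: the two players act simultaneously and independently. -/
def histIntM (p0 : Measure X) (q : Kernel (X × A1 × A2) X)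
    (ν1 : ∀ n : ℕ, InfoM X A1 n → Measure A1)
    (ν2 : ∀ n : ℕ, HistM X A1 A2 n → Measure A2) :
    ∀ n : ℕ, (HistM X A1 A2 n → ℝ≥0∞) → ℝ≥0∞
  | 0, g => ∫⁻ x, g (Fin.elim0, x) ∂p0
  | n + 1, g => histIntM p0 q ν1 ν2 n fun h =>
      ∫⁻ a1, ∫⁻ a2, ∫⁻ y, g (Fin.snoc h.1 (h.2, a1, a2), y)
        ∂(q (h.2, a1, a2)) ∂(ν2 n h) ∂(ν1 n (infoM h))

/-- `InducesM q π1 π2 p0 p` says that `p` is the strategic measure `ρ_{p0}[π₁, π₂]`. -/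
def InducesM (q : Kernel (X × A1 × A2) X) {Acts1 : X → Set A1} {Acts2 : X → Set A2}
    (π1 : Policy1 Acts1) (π2 : Policy2 A1 Acts2)
    (p0 : Measure X) (p : Measure (TrajM X A1 A2)) : Prop :=
  ∀ (n : ℕ) (B : Set (HistM X A1 A2 n)), MeasurableSet B →
    p {ω : TrajM X A1 A2 | ((fun i : Fin n => ω i.val), (ω n).1) ∈ B}
      = histIntM p0 q π1.μ π2.μ n (B.indicator fun _ => 1)

/-- The set `S_M` of all strategic measures of the minimax control model. -/
def SM (q : Kernel (X × A1 × A2) X) (Acts1 : X → Set A1) (Acts2 : X → Set A2) :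
    Set (ProbabilityMeasure (TrajM X A1 A2)) :=
  {p | ∃ (π1 : Policy1 Acts1) (π2 : Policy2 A1 Acts2) (p0 : ProbabilityMeasure X),
    InducesM q π1 π2 p0.toMeasure p.toMeasure}

/-- The section `tilde-S_M(x)`. -/
def tsecM (q : Kernel (X × A1 × A2) X) (Acts1 : X → Set A1) (Acts2 : X → Set A2) (x : X) :
    Set (ProbabilityMeasure (TrajM X A1 A2)) :=
  {p | p ∈ SM q Acts1 Acts2 ∧ p.toMeasure.map (fun ω => (ω 0).1) = Measure.dirac x}

/-- The set `tilde-S_M ⊂ 𝕏 × P(Ω)`. -/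
def tsetM (q : Kernel (X × A1 × A2) X) (Acts1 : X → Set A1) (Acts2 : X → Set A2) :
    Set (X × ProbabilityMeasure (TrajM X A1 A2)) :=
  {xp | xp.2 ∈ tsecM q Acts1 Acts2 xp.1}

/-- Assumption `AC` (Assumption 4.1 / `cond-minimax-abscont`): while player 1 uses the same
policy, the marginal distributions of the induced processes on the controller information
spaces `I_n` are mutually absolutely continuous. -/
def AssumpAC (q : Kernel (X × A1 × A2) X) (Acts1 : X → Set A1) (Acts2 : X → Set A2) : Prop :=
  ∀ (π1 : Policy1 Acts1) (π2 π2' : Policy2 A1 Acts2) (x : X)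
    (p p' : ProbabilityMeasure (TrajM X A1 A2)),
    InducesM q π1 π2 (Measure.dirac x) p.toMeasure →
    InducesM q π1 π2' (Measure.dirac x) p'.toMeasure →
    ∀ n : ℕ, p.toMeasure.map (iProjM n) ≪ p'.toMeasure.map (iProjM n)

end PaperStmt

namespace PaperStmt

variable {X A1 A2 : Type*} [MeasurableSpace X] [MeasurableSpace A1] [MeasurableSpace A2]
  [TopologicalSpace X] [OpensMeasurableSpace X] [TopologicalSpace A1] [OpensMeasurableSpace A1]
  [TopologicalSpace A2] [OpensMeasurableSpace A2]

/-- The set `Ŝ_M`, defined from a fixed Borel measurable family `ν` of conditional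
distributions of `a¹_n` given `i_n`. -/
def hatSM (q : Kernel (X × A1 × A2) X) (Acts1 : X → Set A1) (Acts2 : X → Set A2)
    (ν : ∀ n : ℕ, InfoM X A1 n × ProbabilityMeasure (TrajM X A1 A2) → Measure A1) :
    Set (X × ProbabilityMeasure (TrajM X A1 A2) × ProbabilityMeasure (TrajM X A1 A2)) :=
  {t | (t.1, t.2.1) ∈ tsetM q Acts1 Acts2 ∧ (t.1, t.2.2) ∈ tsetM q Acts1 Acts2 ∧
    (∀ n : ℕ,
      t.2.2.toMeasure {ω | ν n (iProjM n ω, t.2.2) = ν n (iProjM n ω, t.2.1)} = 1) ∧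
    (∀ n : ℕ, t.2.2.toMeasure.map (iProjM n) ≪ t.2.1.toMeasure.map (iProjM n))}

end PaperStmt

namespace PaperStmt

section Souslin

/-- A Borel subset of a space that is itself analytic is analytic. -/
theorem analyticSet_of_measurableSet {Y : Type*} [TopologicalSpace Y] [MeasurableSpace Y]
    (hY : AnalyticSet (Set.univ : Set Y))
    (hmeas : ∀ f : (ℕ → ℕ) → Y, Continuous f → Measurable f) {B : Set Y} (hB : MeasurableSet B) :
    AnalyticSet B := by
  rw [AnalyticSet] at hY
  rcases hY with h | ⟨f, hf, hr⟩
  · rw [Set.subset_eq_empty (Set.subset_univ B) h]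
    exact analyticSet_empty
  · have h := ((hmeas f hf) hB).analyticSet.image_of_continuous hf
    rwa [Set.image_preimage_eq _ (Set.range_eq_univ.1 hr)] at h

/-- Continuous preimages of analytic sets are analytic when the domain is analytic. -/
theorem analyticSet_preimage {Y Z : Type*} [TopologicalSpace Y]
    [TopologicalSpace Z] [T2Space Z] (hY : AnalyticSet (Set.univ : Set Y)) {φ : Y → Z}
    (hφ : Continuous φ) {A : Set Z} (hA : AnalyticSet A) : AnalyticSet (φ ⁻¹' A) := by
  rw [AnalyticSet] at hY hA
  rcases hY with h | ⟨g, hg, hr⟩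
  · rw [Set.subset_eq_empty (Set.subset_univ (φ ⁻¹' A)) h]
    exact analyticSet_empty
  rcases hA with rfl | ⟨f, hf, rfl⟩
  · simpa using analyticSet_empty
  have hc : IsClosed {z : (ℕ → ℕ) × (ℕ → ℕ) | φ (g z.1) = f z.2} :=
    isClosed_eq (hφ.comp (hg.comp continuous_fst)) (hf.comp continuous_snd)
  convert hc.analyticSet.image_of_continuous (hg.comp continuous_fst) using 1
  ext y
  constructor
  · rintro ⟨w, hw⟩
    obtain ⟨v, rfl⟩ := Set.range_eq_univ.1 hr y
    exact ⟨(v, w), hw.symm, rfl⟩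
  · rintro ⟨⟨v, w⟩, h, rfl⟩
    exact ⟨w, h.symm⟩

theorem analyticSet_univ_prod {Y Z : Type*} [TopologicalSpace Y] [TopologicalSpace Z]
    (hY : AnalyticSet (Set.univ : Set Y)) (hZ : AnalyticSet (Set.univ : Set Z)) :
    AnalyticSet (Set.univ : Set (Y × Z)) := by
  rw [AnalyticSet] at hY hZ
  rcases hY with h | ⟨g, hg, hr⟩
  · have : (Set.univ : Set (Y × Z)) = ∅ := by
      rw [← Set.univ_prod_univ, h, Set.empty_prod]
    rw [this]; exact analyticSet_empty
  rcases hZ with h | ⟨f, hf, hr'⟩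
  · have : (Set.univ : Set (Y × Z)) = ∅ := by
      rw [← Set.univ_prod_univ, h, Set.prod_empty]
    rw [this]; exact analyticSet_empty
  have := analyticSet_range_of_polishSpace (hg.prodMap hf)
  rwa [Set.range_prodMap, hr, hr', Set.univ_prod_univ] at this

theorem analyticSet_univ_of_polishSpace (Y : Type*) [TopologicalSpace Y] [PolishSpace Y] :
    AnalyticSet (Set.univ : Set Y) := isClosed_univ.analyticSet

end Souslin

section ProbabilityMeasure

variable {Ω : Type*} [TopologicalSpace Ω] [PolishSpace Ω] [MeasurableSpace Ω] [BorelSpace Ω]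

/-- Evaluation at Borel sets is Borel for the topology of weak convergence. -/
theorem measurable_probabilityMeasure_toMeasure :
    Measurable (fun p : ProbabilityMeasure Ω => p.toMeasure) := by
  have : BorelSpace (ProbabilityMeasure Ω) := ⟨rfl⟩
  refine Measurable.measure_of_isPiSystem_of_isProbabilityMeasure
    (BorelSpace.measurable_eq (α := Ω)) isPiSystem_isOpen fun G hG => ?_
  refine LowerSemicontinuous.measurable fun p r hr => ?_
  have h := ProbabilityMeasure.le_liminf_measure_open_of_tendsto (tendsto_id (x := 𝓝 p)) hG
  exact eventually_lt_of_lt_liminf (lt_of_lt_of_le hr h)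

/-- The identity kernel from the space of probability measures. -/
def probKernel (Ω : Type*) [TopologicalSpace Ω] [PolishSpace Ω] [MeasurableSpace Ω]
    [BorelSpace Ω] : Kernel (ProbabilityMeasure Ω) Ω :=
  ⟨fun p => p.toMeasure, measurable_probabilityMeasure_toMeasure⟩

@[simp] theorem probKernel_apply (p : ProbabilityMeasure Ω) : probKernel Ω p = p.toMeasure := rfl

instance : IsMarkovKernel (probKernel Ω) := ⟨fun p => by rw [probKernel_apply]; infer_instance⟩

theorem isInducing_map_of_isEmbedding {Ω K : Type*} [TopologicalSpace Ω]
    [MeasurableSpace Ω] [BorelSpace Ω] [TopologicalSpace K] [PolishSpace K]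
    [MeasurableSpace K] [BorelSpace K]
    {e : Ω → K} (he : Topology.IsEmbedding e) :
    Topology.IsInducing
      (fun p : ProbabilityMeasure Ω => p.map he.continuous.measurable.aemeasurable) := by
  rw [Topology.isInducing_iff_nhds]
  intro p
  refine le_antisymm (((ProbabilityMeasure.continuous_map he.continuous).tendsto p).le_comap) ?_
  have key : Tendsto (fun p : ProbabilityMeasure Ω => p)
      (comap (fun p : ProbabilityMeasure Ω => p.map he.continuous.measurable.aemeasurable)
        (𝓝 (p.map he.continuous.measurable.aemeasurable))) (𝓝 p) := by
    refine tendsto_of_forall_isOpen_le_liminf' fun G hG => ?_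
    obtain ⟨V, hV, rfl⟩ := he.isOpen_iff.1 hG
    have h := ProbabilityMeasure.le_liminf_measure_open_of_tendsto
      (tendsto_comap (f := fun p : ProbabilityMeasure Ω =>
        p.map he.continuous.measurable.aemeasurable)
        (x := 𝓝 (p.map he.continuous.measurable.aemeasurable))) hV
    simpa [ProbabilityMeasure.map, Measure.map_apply he.continuous.measurable hV.measurableSet]
      using h
  exact (map_id' (f := comap (fun p : ProbabilityMeasure Ω =>
    p.map he.continuous.measurable.aemeasurable) _)).symm.trans_le key

/-- The space of Borel probability measures on a Polish space is analytic. -/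
theorem analyticSet_univ_probabilityMeasure :
    AnalyticSet (Set.univ : Set (ProbabilityMeasure Ω)) := by
  let := TopologicalSpace.upgradeIsCompletelyMetrizable Ω
  obtain ⟨e, he⟩ := Metric.PiNatEmbed.exists_embedding_to_hilbert_cube (X := Ω)
  have hem : MeasurableEmbedding e := he.continuous.measurableEmbedding he.injective
  let E : ProbabilityMeasure Ω → ProbabilityMeasure (ℕ → unitInterval) :=
    fun p => p.map he.continuous.measurable.aemeasurable
  have hE : Topology.IsInducing E := isInducing_map_of_isEmbedding he
  let := TopologicalSpace.metrizableSpaceMetric (ProbabilityMeasure (ℕ → unitInterval))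
  have : BorelSpace (ProbabilityMeasure (ℕ → unitInterval)) := ⟨rfl⟩
  have hr : Set.range E = {p | p.toMeasure (Set.range e) = 1} := by
    ext p
    constructor
    · rintro ⟨p, rfl⟩
      change Measure.map e p.toMeasure (Set.range e) = 1
      simp [Measure.map_apply he.continuous.measurable hem.measurableSet_range]
    · intro hp
      have h1 : Measure.map e (p.toMeasure.comap e) = p.toMeasure := by
        rw [hem.map_comap, Measure.restrict_eq_self_of_ae_mem]
        exact (mem_ae_iff_prob_eq_one hem.measurableSet_range).2 hp
      have h2 : IsProbabilityMeasure (p.toMeasure.comap e) := by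
        constructor
        have : Measure.map e (p.toMeasure.comap e) Set.univ = 1 := by rw [h1]; simp
        rwa [Measure.map_apply he.continuous.measurable .univ, Set.preimage_univ] at this
      exact ⟨⟨p.toMeasure.comap e, h2⟩, Subtype.ext h1⟩
  have hmr : AnalyticSet (Set.range E) := by
    refine MeasurableSet.analyticSet ?_
    rw [hr]
    exact ((Measure.measurable_coe hem.measurableSet_range).comp
      measurable_probabilityMeasure_toMeasure) (measurableSet_singleton 1)
  rw [AnalyticSet] at hmr
  rcases hmr with h | ⟨f, hf, hfr⟩
  · have : IsEmpty (ProbabilityMeasure Ω) := Set.range_eq_empty_iff.1 h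
    rw [Set.univ_eq_empty_iff.2 this]
    exact analyticSet_empty
  · have hinj : Function.Injective E := hE.injective
    have hx : ∀ y, ∃ p, E p = f y := fun y => by
      have : f y ∈ Set.range E := hfr ▸ Set.mem_range_self y
      exact this
    choose g hg using hx
    have hgc : Continuous g := hE.continuous_iff.2 (by
      convert hf using 1
      exact funext hg)
    rw [AnalyticSet]
    refine Or.inr ⟨g, hgc, Set.eq_univ_of_forall fun p => ?_⟩
    have : E p ∈ Set.range f := hfr ▸ Set.mem_range_self p
    obtain ⟨y, hy⟩ := this
    exact ⟨y, hinj ((hg y).trans hy)⟩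

end ProbabilityMeasure
end PaperStmt

namespace PaperStmt

section Capacity

/-- The sequences dominated by `x` in their first `k` coordinates. -/
def boundedPrefix (x : ℕ → ℕ) (k : ℕ) : Set (ℕ → ℕ) := {y | ∀ i < k, y i ≤ x i}

theorem boundedPrefix_congr {x y : ℕ → ℕ} {k : ℕ} (h : ∀ i < k, x i = y i) :
    boundedPrefix x k = boundedPrefix y k := by
  ext z
  exact forall₂_congr fun i hi => by rw [h i hi]

theorem boundedPrefix_zero (x : ℕ → ℕ) : boundedPrefix x 0 = Set.univ := by
  simp [boundedPrefix]

theorem boundedPrefix_antitone (x : ℕ → ℕ) : Antitone (boundedPrefix x) :=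
  fun _ _ h _ hy i hi => hy i (hi.trans_le h)

theorem isCompact_Iic_nat_nat (x : ℕ → ℕ) : IsCompact (Set.Iic x) := by
  rw [← Set.pi_univ_Iic]
  exact isCompact_univ_pi fun i => (Set.finite_Iic (x i)).isCompact

/-- A neighbourhood of `{y | y ≤ x}` contains some `boundedPrefix x k`. -/
theorem exists_boundedPrefix_subset {x : ℕ → ℕ} {W : Set (ℕ → ℕ)} (hW : IsOpen W)
    (h : Set.Iic x ⊆ W) : ∃ k, boundedPrefix x k ⊆ W := by
  by_contra! hk
  simp only [Set.not_subset] at hk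
  choose z hz hzW using hk
  have hmem : ∀ k, z k ⊓ x ∈ Set.Iic x := fun k => Set.mem_Iic.2 inf_le_right
  obtain ⟨a, ha, φ, hφ, hlim⟩ := (isCompact_Iic_nat_nat x).tendsto_subseq hmem
  have hlim' : Tendsto (z ∘ φ) atTop (𝓝 a) := by
    rw [tendsto_pi_nhds] at hlim ⊢
    intro i
    refine (hlim i).congr' ?_
    filter_upwards [hφ.tendsto_atTop.eventually_gt_atTop i] with k hk
    exact inf_eq_left.2 (hz (φ k) i hk)
  have : a ∈ Wᶜ := hW.isClosed_compl.mem_of_tendsto hlim' (Eventually.of_forall fun k => hzW _)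
  exact this (h ha)

theorem exists_lt_measure_image_boundedPrefix {Ω : Type*} [MeasurableSpace Ω] (μ : Measure Ω)
    (f : (ℕ → ℕ) → Ω) {s : ℝ≥0∞} (hs : s < μ (Set.range f)) :
    ∃ x, ∀ k, s < μ (f '' boundedPrefix x k) := by
  have step : ∀ (x : ℕ → ℕ) (k : ℕ), s < μ (f '' boundedPrefix x k) →
      ∃ m, s < μ (f '' boundedPrefix (Function.update x k m) (k + 1)) := by
    intro x k hk
    have hU : f '' boundedPrefix x k
        = ⋃ m, f '' boundedPrefix (Function.update x k m) (k + 1) := by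
      rw [← Set.image_iUnion]
      congr 1
      ext y
      simp only [Set.mem_iUnion]
      constructor
      · intro hy
        refine ⟨y k, fun i hi => ?_⟩
        rcases (Nat.lt_succ_iff_lt_or_eq.1 hi) with h | rfl
        · rw [Function.update_of_ne h.ne]; exact hy i h
        · simp
      · rintro ⟨m, hm⟩ i hi
        have := hm i (hi.trans (Nat.lt_succ_self k))
        rwa [Function.update_of_ne hi.ne] at this
    have hmono : Monotone fun m => f '' boundedPrefix (Function.update x k m) (k + 1) := by
      intro m m' hm
      refine Set.image_mono fun y hy i hi => (hy i hi).trans ?_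
      exact update_le_update_iff.2 ⟨hm, fun _ _ => le_rfl⟩ i
    rw [hU, hmono.measure_iUnion, lt_iSup_iff] at hk
    exact hk
  choose! m hm using step
  let w : ℕ → ℕ → ℕ := fun n => Nat.rec (fun _ => 0) (fun k x => Function.update x k (m x k)) n
  have hw : ∀ k, s < μ (f '' boundedPrefix (w k) k) := by
    intro k
    induction k with
    | zero => rwa [boundedPrefix_zero, Set.image_univ]
    | succ k ih => exact hm _ _ ih
  have hstab : ∀ k i, i < k → w k i = w (i + 1) i := by
    intro k i hi
    induction k, (Nat.succ_le_of_lt hi) using Nat.le_induction with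
    | base => rfl
    | succ k hk ih =>
      rw [← ih (Nat.lt_of_succ_le hk)]
      exact Function.update_of_ne (Nat.lt_of_succ_le hk).ne _ _
  refine ⟨fun i => w (i + 1) i, fun k => ?_⟩
  rw [← boundedPrefix_congr (hstab k)]
  exact hw k

variable {Ω : Type*} [TopologicalSpace Ω] [T2Space Ω]

theorem iInter_closure_image_boundedPrefix_subset {f : (ℕ → ℕ) → Ω} (hf : Continuous f)
    (x : ℕ → ℕ) : ⋂ k, closure (f '' boundedPrefix x k) ⊆ f '' Set.Iic x := by
  intro y hy
  by_contra hn
  obtain ⟨U, V, hU, hV, hyU, hKV, hUV⟩ := SeparatedNhds.of_isCompact_isCompact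
    (isCompact_singleton (x := y)) ((isCompact_Iic_nat_nat x).image hf)
    (Set.disjoint_singleton_left.2 hn)
  obtain ⟨k, hk⟩ := exists_boundedPrefix_subset (hV.preimage hf) (Set.image_subset_iff.1 hKV)
  obtain ⟨z, hzU, hz⟩ := mem_closure_iff.1 (Set.mem_iInter.1 hy k) U hU (hyU rfl)
  exact Set.disjoint_left.1 hUV hzU (Set.image_subset_iff.2 hk hz)

variable [MeasurableSpace Ω] [OpensMeasurableSpace Ω]

theorem le_measure_image_Iic (μ : Measure Ω) [IsFiniteMeasure μ] {f : (ℕ → ℕ) → Ω}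
    (hf : Continuous f) {x : ℕ → ℕ} {s : ℝ≥0∞}
    (h : ∀ k, s ≤ μ (closure (f '' boundedPrefix x k))) : s ≤ μ (f '' Set.Iic x) := by
  refine le_trans ?_ (measure_mono (iInter_closure_image_boundedPrefix_subset hf x))
  rw [Antitone.measure_iInter
    (fun k l hkl => closure_mono (Set.image_mono (boundedPrefix_antitone x hkl)))
    (fun k => isClosed_closure.measurableSet.nullMeasurableSet) ⟨0, measure_ne_top _ _⟩]
  exact le_iInf h

/-- Analytic sets are universally measurable. -/
theorem nullMeasurableSet_of_analyticSet (μ : Measure Ω) [IsFiniteMeasure μ] {A : Set Ω}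
    (hA : AnalyticSet A) : NullMeasurableSet A μ := by
  rw [AnalyticSet] at hA
  rcases hA with rfl | ⟨f, hf, rfl⟩
  · exact MeasurableSet.empty.nullMeasurableSet
  rcases eq_or_ne (μ (Set.range f)) 0 with h0 | h0
  · exact NullMeasurableSet.of_null h0
  obtain ⟨u, -, hu, hlim⟩ := exists_seq_strictMono_tendsto' (pos_iff_ne_zero.2 h0)
  have hx : ∀ n, ∃ x, u n ≤ μ (f '' Set.Iic x) := by
    intro n
    obtain ⟨x, hx⟩ := exists_lt_measure_image_boundedPrefix μ f (hu n).2
    exact ⟨x, le_measure_image_Iic μ hf fun k =>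
      (hx k).le.trans (measure_mono subset_closure)⟩
  choose x hx using hx
  have hT : MeasurableSet (⋃ n, f '' Set.Iic (x n)) :=
    .iUnion fun n => ((isCompact_Iic_nat_nat (x n)).image hf).measurableSet
  have hTA : ⋃ n, f '' Set.Iic (x n) ⊆ Set.range f :=
    Set.iUnion_subset fun n => Set.image_subset_range _ _
  have hle : μ (Set.range f) ≤ μ (⋃ n, f '' Set.Iic (x n)) :=
    le_of_tendsto' hlim fun n =>
      (hx n).trans (measure_mono (Set.subset_iUnion (fun n => f '' Set.Iic (x n)) n))
  have heq : (⋃ n, f '' Set.Iic (x n) : Set Ω) =ᵐ[μ] toMeasurable μ (Set.range f) :=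
    ae_eq_of_subset_of_measure_ge (hTA.trans (subset_toMeasurable _ _))
      (by rwa [measure_toMeasurable]) hT.nullMeasurableSet (measure_ne_top _ _)
  refine ⟨_, hT, ?_⟩
  exact ((LE.le.eventuallyLE (subset_toMeasurable μ (Set.range f))).trans
    heq.symm.le).antisymm (LE.le.eventuallyLE hTA)

end Capacity

/-- The set of probability measures giving full mass to an analytic set is analytic. -/
theorem analyticSet_setOf_measure_eq_one {Ω : Type*} [TopologicalSpace Ω] [PolishSpace Ω]
    [MeasurableSpace Ω] [BorelSpace Ω] {A : Set Ω} (hA : AnalyticSet A) :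
    AnalyticSet {p : ProbabilityMeasure Ω | p.toMeasure A = 1} := by
  rw [AnalyticSet] at hA
  rcases hA with rfl | ⟨f, hf, rfl⟩
  · simpa using analyticSet_empty
  have : BorelSpace (ProbabilityMeasure Ω) := ⟨rfl⟩
  obtain ⟨u, -, hu, hlim⟩ := exists_seq_strictMono_tendsto' (zero_lt_one (α := ℝ≥0∞))
  let D : ℕ → Set (ProbabilityMeasure Ω × (ℕ → ℕ)) := fun n =>
    {z | ∀ k, u n ≤ z.1.toMeasure (closure (f '' boundedPrefix z.2 k))}
  have hD : ∀ n, MeasurableSet (D n) := by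
    intro n
    simp only [D, Set.ofPred_forall]
    refine .iInter fun k => measurableSet_le measurable_const ?_
    let C : (Fin k → ℕ) → Set Ω := fun t =>
      closure (f '' boundedPrefix (fun i => if h : i < k then t ⟨i, h⟩ else 0) k)
    let G : ProbabilityMeasure Ω × (Fin k → ℕ) → ℝ≥0∞ := fun z => z.1.toMeasure (C z.2)
    have hG : Measurable G := measurable_from_prod_countable_left fun t =>
      (Measure.measurable_coe (s := C t) isClosed_closure.measurableSet).comp
        measurable_probabilityMeasure_toMeasure
    have hr : Measurable fun z : ProbabilityMeasure Ω × (ℕ → ℕ) =>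
        (z.1, fun i : Fin k => z.2 i) := by fun_prop
    convert hG.comp hr using 1
    ext z
    simp only [G, C, Function.comp_apply]
    rw [boundedPrefix_congr]
    intro i hi
    simp [hi]
  have heq : {p : ProbabilityMeasure Ω | p.toMeasure (Set.range f) = 1}
      = ⋂ n, Prod.fst '' (D n) := by
    ext p
    simp only [Set.mem_ofPred_eq, Set.mem_iInter]
    constructor
    · intro hp n
      obtain ⟨x, hx⟩ := exists_lt_measure_image_boundedPrefix p.toMeasure f
        (s := u n) (by rw [hp]; exact (hu n).2)
      exact ⟨(p, x), fun k => (hx k).le.trans (measure_mono subset_closure), rfl⟩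
    · intro hp
      refine le_antisymm prob_le_one (le_of_tendsto' hlim fun n => ?_)
      obtain ⟨⟨p', x⟩, hx, rfl⟩ := hp n
      exact (le_measure_image_Iic p'.toMeasure hf hx).trans
        (measure_mono (Set.image_subset_range _ _))
  rw [heq]
  refine AnalyticSet.iInter fun n => AnalyticSet.image_of_continuous ?_ continuous_fst
  refine analyticSet_of_measurableSet
    (analyticSet_univ_prod analyticSet_univ_probabilityMeasure (analyticSet_univ_of_polishSpace _))
    (fun g hg => ?_) (hD n)
  exact (hg.fst.measurable).prodMk (hg.snd.measurable)

end PaperStmt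

namespace PaperStmt

theorem exists_countable_isPiSystem_generateFrom (Z : Type*) [m : MeasurableSpace Z]
    [MeasurableSpace.CountablyGenerated Z] :
    ∃ S : Set (Set Z), S.Countable ∧ IsPiSystem S ∧ m = MeasurableSpace.generateFrom S := by
  refine ⟨generateSetAlgebra (MeasurableSpace.countableGeneratingSet Z),
    countable_generateSetAlgebra MeasurableSpace.countable_countableGeneratingSet,
    fun s hs t ht _ => isSetAlgebra_generateSetAlgebra.inter_mem hs ht, ?_⟩
  rw [generateFrom_generateSetAlgebra_eq, MeasurableSpace.generateFrom_countableGeneratingSet]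

theorem measurableSet_setOf_measure_eq {T Z : Type*} [MeasurableSpace T] [MeasurableSpace Z]
    [MeasurableSpace.CountablyGenerated Z] {F G : T → Measure Z} (hF : Measurable F)
    (hG : Measurable G) (hFp : ∀ t, IsProbabilityMeasure (F t))
    (hGp : ∀ t, IsProbabilityMeasure (G t)) : MeasurableSet {t | F t = G t} := by
  obtain ⟨S, hSc, hSpi, hSgen⟩ := exists_countable_isPiSystem_generateFrom Z
  have hSm : ∀ s ∈ S, MeasurableSet s := fun s hs => by
    rw [hSgen]; exact MeasurableSpace.measurableSet_generateFrom hs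
  have : {t | F t = G t} = ⋂ s ∈ S, {t | F t s = G t s} := by
    ext t
    simp only [Set.mem_iInter]
    refine ⟨fun h s _ => congrArg (fun m : Measure Z => m s) h, fun h => ?_⟩
    have := hFp t
    have := hGp t
    exact ext_of_generate_finite S hSgen hSpi h (by simp)
  rw [this]
  refine MeasurableSet.biInter hSc fun s hs => ?_
  exact measurableSet_eq_fun ((Measure.measurable_coe (hSm s hs)).comp hF)
    ((Measure.measurable_coe (hSm s hs)).comp hG)

theorem exists_markovKernel_ae_eq {I A : Type*} [MeasurableSpace I] [MeasurableSpace A]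
    [MeasurableSpace.CountablyGenerated A] [Nonempty A] {π : I → Measure A}
    (hp : ∀ i, IsProbabilityMeasure (π i))
    (hπ : ∀ B, MeasurableSet B → UniversallyMeasurable fun i => π i B)
    (μ : Measure I) [IsProbabilityMeasure μ] :
    ∃ κ : Kernel I A, IsMarkovKernel κ ∧ ∀ᵐ i ∂μ, κ i = π i := by
  classical
  obtain ⟨S, hSc, hSpi, hSgen⟩ := exists_countable_isPiSystem_generateFrom A
  have hSm : ∀ s ∈ S, MeasurableSet s := fun s hs => by
    rw [hSgen]; exact MeasurableSpace.measurableSet_generateFrom hs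
  have haem : ∀ s ∈ S, AEMeasurable (fun i => π i s) μ := fun s hs =>
    NullMeasurable.aemeasurable fun t ht => hπ s (hSm s hs) t ht μ inferInstance
  have hae : ∀ᵐ i ∂μ, ∀ s (hs : s ∈ S), (haem s hs).mk _ i = π i s :=
    (ae_ball_iff hSc).2 fun s hs => (haem s hs).ae_eq_mk.symm
  obtain ⟨N, hN, hNm, hN0⟩ := exists_measurable_superset_of_null (ae_iff.1 hae)
  have hNmem : ∀ i, i ∉ N → ∀ s (hs : s ∈ S), (haem s hs).mk _ i = π i s := fun i hi => by
    by_contra h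
    exact hi (hN h)
  let a : A := Classical.arbitrary A
  let κ : I → Measure A := fun i => if i ∈ N then Measure.dirac a else π i
  have hκp : ∀ i, IsProbabilityMeasure (κ i) := fun i => by
    by_cases h : i ∈ N
    · simp only [κ, h, if_true]; infer_instance
    · simp only [κ, h, if_false]; exact hp i
  have hκ : Measurable κ := by
    refine Measurable.measure_of_isPiSystem_of_isProbabilityMeasure hSgen hSpi fun s hs => ?_
    have : (fun i => κ i s) = fun i =>
        if i ∈ N then Measure.dirac a s else (haem s hs).mk _ i := by
      funext i
      by_cases h : i ∈ N
      · simp [κ, h]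
      · simp [κ, h, hNmem i h s hs]
    rw [this]
    exact Measurable.ite hNm measurable_const (haem s hs).measurable_mk
  refine ⟨⟨κ, hκ⟩, ⟨hκp⟩, ?_⟩
  have : ∀ᵐ i ∂μ, i ∉ N := measure_eq_zero_iff_ae_notMem.1 hN0
  filter_upwards [this] with i hi
  change κ i = π i
  simp [κ, hi]

theorem universallyMeasurableSet_of_analyticSet {Ω : Type*} [MeasurableSpace Ω]
    [TopologicalSpace Ω] [T2Space Ω] [OpensMeasurableSpace Ω] {A : Set Ω}
    (hA : AnalyticSet A) : UniversallyMeasurableSet A :=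
  fun μ _ => nullMeasurableSet_of_analyticSet μ hA

theorem UniversallyMeasurableSet.preimage {Y Z : Type*} [MeasurableSpace Y] [MeasurableSpace Z]
    {s : Set Z} (hs : UniversallyMeasurableSet s) {f : Y → Z} (hf : Measurable f) :
    UniversallyMeasurableSet (f ⁻¹' s) := fun μ _ =>
  (hs (μ.map f) (Measure.isProbabilityMeasure_map hf.aemeasurable)).preimage
    ⟨hf, Measure.AbsolutelyContinuous.rfl⟩

theorem UniversallyMeasurableSet.inter {Z : Type*} [MeasurableSpace Z]
    {s t : Set Z} (hs : UniversallyMeasurableSet s) (ht : UniversallyMeasurableSet t) :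
    UniversallyMeasurableSet (s ∩ t) :=
  fun μ h => (hs μ h).inter (ht μ h)

section Feasible

variable {I A : Type*} [MeasurableSpace I] [MeasurableSpace A] {S : Set (I × A)}

/-- Almost every section of a universally measurable set is null measurable, and its measure agrees
with that of a measurable modification. -/
theorem UniversallyMeasurableSet.exists_measurable_ae_section_eq
    (hS : UniversallyMeasurableSet S) (μ : Measure I) [IsProbabilityMeasure μ]
    (κ : Kernel I A) [IsMarkovKernel κ] :
    ∃ T, MeasurableSet T ∧ (μ ⊗ₘ κ) S = (μ ⊗ₘ κ) T ∧
      ∀ᵐ i ∂μ, κ i (Prod.mk i ⁻¹' S) = κ i (Prod.mk i ⁻¹' T) := by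
  obtain ⟨T, hT, hTS⟩ := hS (μ ⊗ₘ κ) inferInstance
  refine ⟨T, hT, measure_congr hTS, ?_⟩
  filter_upwards [Measure.ae_ae_of_ae_compProd hTS] with i hi
  exact measure_congr hi

theorem UniversallyMeasurableSet.compProd_eq_one_iff
    (hS : UniversallyMeasurableSet S) (μ : Measure I) [IsProbabilityMeasure μ]
    (κ : Kernel I A) [IsMarkovKernel κ] :
    (μ ⊗ₘ κ) S = 1 ↔ ∀ᵐ i ∂μ, κ i (Prod.mk i ⁻¹' S) = 1 := by
  obtain ⟨T, hT, h1, h2⟩ := hS.exists_measurable_ae_section_eq μ κ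
  have h3 : (∀ᵐ i ∂μ, κ i (Prod.mk i ⁻¹' S) = 1) ↔ ∀ᵐ i ∂μ, κ i (Prod.mk i ⁻¹' T) = 1 :=
    eventually_congr (by filter_upwards [h2] with i hi; rw [hi])
  rw [h1, h3, ← mem_ae_iff_prob_eq_one₀ hT.nullMeasurableSet]
  refine (Measure.ae_compProd_iff (p := fun z => z ∈ T) hT).trans (eventually_congr ?_)
  filter_upwards with i
  exact mem_ae_iff_prob_eq_one₀ (measurable_prodMk_left hT).nullMeasurableSet

theorem UniversallyMeasurableSet.setOf_section_eq_one
    (hS : UniversallyMeasurableSet S) (κ : Kernel I A) [IsMarkovKernel κ] :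
    UniversallyMeasurableSet {i | κ i (Prod.mk i ⁻¹' S) = 1} := fun μ _ => by
  obtain ⟨T, hT, h1, h2⟩ := hS.exists_measurable_ae_section_eq μ κ
  have hm : MeasurableSet {i | κ i (Prod.mk i ⁻¹' T) = 1} :=
    (Kernel.measurable_kernel_prodMk_left hT) (measurableSet_singleton 1)
  refine hm.nullMeasurableSet.congr ?_
  filter_upwards [h2] with i hi
  have : i ∈ {i | κ i (Prod.mk i ⁻¹' T) = 1} ↔ i ∈ {i | κ i (Prod.mk i ⁻¹' S) = 1} := by
    rw [Set.mem_ofPred_eq, Set.mem_ofPred_eq, hi]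
  exact propext this

end Feasible

/-- Gluing two universally measurable functions along a universally measurable set. -/
theorem universallyMeasurable_ite {I Z : Type*} [MeasurableSpace I] [MeasurableSpace Z]
    {S : Set I} [DecidablePred (· ∈ S)] (hS : UniversallyMeasurableSet S) {f g : I → Z}
    (hf : UniversallyMeasurable f) (hg : UniversallyMeasurable g) :
    UniversallyMeasurable fun i => if i ∈ S then f i else g i := fun t ht μ hμ => by
  have : (fun i => if i ∈ S then f i else g i) ⁻¹' t = (f ⁻¹' t ∩ S) ∪ (g ⁻¹' t \ S) := by
    ext i
    by_cases h : i ∈ S <;> simp [h]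
  rw [this]
  exact ((hf t ht μ hμ).inter (hS μ hμ)).union ((hg t ht μ hμ).diff (hS μ hμ))

theorem universallyMeasurable_of_measurable {I Z : Type*} [MeasurableSpace I] [MeasurableSpace Z]
    {f : I → Z} (hf : Measurable f) : UniversallyMeasurable f :=
  fun _ ht _ _ => (hf ht).nullMeasurableSet

end PaperStmt

namespace PaperStmt

section Projections

variable {X A1 A2 : Type*}

/-- The history up to time `n` along a trajectory. -/
def histProj (n : ℕ) (ω : TrajM X A1 A2) : HistM X A1 A2 n :=
  ((fun i : Fin n => ω i.val), (ω n).1)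

/-- Extend a history by an action pair and the next state. -/
def histSnoc {n : ℕ} (z : (HistM X A1 A2 n × A1 × A2) × X) : HistM X A1 A2 (n + 1) :=
  (Fin.snoc (α := fun _ => X × A1 × A2) z.1.1.1 (z.1.1.2, z.1.2), z.2)

/-- Split off the last action pair and the last state of a history. -/
def histInit {n : ℕ} (h : HistM X A1 A2 (n + 1)) : (HistM X A1 A2 n × A1 × A2) × X :=
  (((fun i => h.1 i.castSucc, (h.1 (Fin.last n)).1), (h.1 (Fin.last n)).2), h.2)

@[simp] theorem histInit_histSnoc {n : ℕ} (z : (HistM X A1 A2 n × A1 × A2) × X) :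
    histInit (histSnoc z) = z := by
  simp [histInit, histSnoc]

theorem histProj_succ (n : ℕ) (ω : TrajM X A1 A2) :
    histProj (n + 1) ω = histSnoc ((histProj n ω, (ω n).2), (ω (n + 1)).1) := by
  refine Prod.ext (funext fun i => ?_) rfl
  refine Fin.lastCases ?_ (fun j => ?_) i
  · simp [histProj, histSnoc]
  · simp [histProj, histSnoc]

variable [MeasurableSpace X] [MeasurableSpace A1] [MeasurableSpace A2]

theorem measurable_histProj (n : ℕ) : Measurable (histProj n : TrajM X A1 A2 → _) := by
  unfold histProj; fun_prop

theorem measurable_infoM {n : ℕ} : Measurable (infoM : HistM X A1 A2 n → InfoM X A1 n) := by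
  unfold infoM; fun_prop

theorem measurable_iProjM (n : ℕ) : Measurable (iProjM n : TrajM X A1 A2 → _) := by
  unfold iProjM; fun_prop

theorem measurable_histSnoc {n : ℕ} :
    Measurable (histSnoc : (HistM X A1 A2 n × A1 × A2) × X → _) := by
  refine Measurable.prodMk (measurable_pi_iff.2 fun i => ?_) measurable_snd
  refine Fin.lastCases ?_ (fun j => ?_) i
  · simp only [Fin.snoc_last]; fun_prop
  · simp only [Fin.snoc_castSucc]; fun_prop

theorem measurable_histInit {n : ℕ} : Measurable (histInit : HistM X A1 A2 (n + 1) → _) := by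
  unfold histInit; fun_prop

/-- The transition kernel as a kernel from histories and action pairs. -/
def stepKernel (q : Kernel (X × A1 × A2) X) (n : ℕ) : Kernel (HistM X A1 A2 n × A1 × A2) X :=
  q.comap (fun z => (z.1.2, z.2)) (by fun_prop)

instance (q : Kernel (X × A1 × A2) X) [IsMarkovKernel q] (n : ℕ) :
    IsMarkovKernel (stepKernel q n) := by
  unfold stepKernel; infer_instance

/-- The joint action kernel of the two players, given the history. -/
def actKernel {n : ℕ} (κ1 : Kernel (InfoM X A1 n) A1) (κ2 : Kernel (HistM X A1 A2 n) A2) :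
    Kernel (HistM X A1 A2 n) (A1 × A2) :=
  (κ1.comap infoM measurable_infoM) ×ₖ κ2

instance {n : ℕ} (κ1 : Kernel (InfoM X A1 n) A1) (κ2 : Kernel (HistM X A1 A2 n) A2)
    [IsMarkovKernel κ1] [IsMarkovKernel κ2] : IsMarkovKernel (actKernel κ1 κ2) := by
  unfold actKernel; infer_instance

end Projections

section Represents

variable {X A1 A2 : Type*} [MeasurableSpace X] [MeasurableSpace A1] [MeasurableSpace A2]

/-- The iterated integral of horizon `n` is integration against the measure `m`. -/
def Represents (p0 : Measure X) (q : Kernel (X × A1 × A2) X)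
    (ν1 : ∀ n : ℕ, InfoM X A1 n → Measure A1) (ν2 : ∀ n : ℕ, HistM X A1 A2 n → Measure A2)
    (n : ℕ) (m : Measure (HistM X A1 A2 n)) : Prop :=
  ∀ g, AEMeasurable g m → histIntM p0 q ν1 ν2 n g = ∫⁻ h, g h ∂m

variable {p0 : Measure X} {q : Kernel (X × A1 × A2) X}
    {ν1 : ∀ n : ℕ, InfoM X A1 n → Measure A1} {ν2 : ∀ n : ℕ, HistM X A1 A2 n → Measure A2}

theorem represents_zero : Represents p0 q ν1 ν2 0 (p0.map fun x => (Fin.elim0, x)) := by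
  intro g hg
  rw [lintegral_map' hg (by fun_prop)]
  rfl

theorem Represents.succ [IsMarkovKernel q] {n : ℕ} {m : Measure (HistM X A1 A2 n)}
    [IsProbabilityMeasure m] (hm : Represents p0 q ν1 ν2 n m)
    (κ1 : Kernel (InfoM X A1 n) A1) (κ2 : Kernel (HistM X A1 A2 n) A2)
    [IsMarkovKernel κ1] [IsMarkovKernel κ2]
    (h1 : ∀ᵐ h ∂m, κ1 (infoM h) = ν1 n (infoM h)) (h2 : ∀ᵐ h ∂m, κ2 h = ν2 n h) :
    Represents p0 q ν1 ν2 (n + 1) (((m ⊗ₘ actKernel κ1 κ2) ⊗ₘ stepKernel q n).map histSnoc) := by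
  intro g hg
  set L := (m ⊗ₘ actKernel κ1 κ2) ⊗ₘ stepKernel q n
  set g0 := hg.mk g
  have hg0 : Measurable g0 := hg.measurable_mk
  have hgg : ∀ᵐ z ∂L, g (histSnoc z) = g0 (histSnoc z) :=
    ae_of_ae_map measurable_histSnoc.aemeasurable hg.ae_eq_mk
  have hgg' := Measure.ae_ae_of_ae_compProd (Measure.ae_ae_of_ae_compProd hgg)
  set G : HistM X A1 A2 n → ℝ≥0∞ := fun h =>
      ∫⁻ a1, ∫⁻ a2, ∫⁻ y, g (Fin.snoc h.1 (h.2, a1, a2), y)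
        ∂(q (h.2, a1, a2)) ∂(ν2 n h) ∂(ν1 n (infoM h))
  set G0 : HistM X A1 A2 n → ℝ≥0∞ := fun h =>
    ∫⁻ a, ∫⁻ y, g0 (histSnoc ((h, a), y)) ∂(stepKernel q n (h, a)) ∂(actKernel κ1 κ2 h)
  have hin : Measurable fun z : HistM X A1 A2 n × A1 × A2 =>
      ∫⁻ y, g0 (histSnoc (z, y)) ∂(stepKernel q n z) :=
    Measurable.lintegral_kernel_prod_right (hg0.comp measurable_histSnoc)
  have hg0' : Measurable fun z => g0 (histSnoc z) := hg0.comp measurable_histSnoc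
  have hG0 : Measurable G0 := Measurable.lintegral_kernel_prod_right hin
  have hG : G =ᵐ[m] G0 := by
    filter_upwards [hgg', h1, h2] with h hh h1 h2
    have hact : actKernel κ1 κ2 h = (κ1 (infoM h)).prod (κ2 h) := by
      rw [actKernel, Kernel.prod_apply, Kernel.comap_apply]
    simp only [G, G0]
    rw [hact] at hh ⊢
    have hin' : Measurable fun a : A1 × A2 =>
        ∫⁻ y, g0 (histSnoc ((h, a), y)) ∂(stepKernel q n (h, a)) :=
      hin.comp measurable_prodMk_left
    rw [lintegral_prod _ hin'.aemeasurable, ← h1, ← h2]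
    refine lintegral_congr_ae ?_
    filter_upwards [Measure.ae_ae_of_ae_prod hh] with a1 ha1
    refine lintegral_congr_ae ?_
    filter_upwards [ha1] with a2 ha2
    exact lintegral_congr_ae ha2
  calc histIntM p0 q ν1 ν2 (n + 1) g = histIntM p0 q ν1 ν2 n G := rfl
    _ = ∫⁻ h, G h ∂m := hm G ⟨G0, hG0, hG⟩
    _ = ∫⁻ h, G0 h ∂m := lintegral_congr_ae hG
    _ = ∫⁻ z, g0 (histSnoc z) ∂L := by
      rw [Measure.lintegral_compProd hg0', Measure.lintegral_compProd hin]
    _ = ∫⁻ z, g (histSnoc z) ∂L := (lintegral_congr_ae hgg).symm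
    _ = _ := (lintegral_map' hg measurable_histSnoc.aemeasurable).symm

end Represents

section Swap

variable {H A B : Type*} [MeasurableSpace H] [MeasurableSpace A] [MeasurableSpace B]

theorem compProd_prod_map_swap (m : Measure H) [IsProbabilityMeasure m] (κ1 : Kernel H A)
    (κ2 : Kernel H B) [IsMarkovKernel κ1] [IsMarkovKernel κ2] :
    (m ⊗ₘ (κ1 ×ₖ κ2)).map (fun z => ((z.1, z.2.2), z.2.1))
      = (m ⊗ₘ κ2) ⊗ₘ κ1.comap Prod.fst measurable_fst := by
  refine Measure.ext_of_lintegral _ fun f hf => ?_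
  have hf1 : Measurable fun z : H × A × B => f ((z.1, z.2.2), z.2.1) := by fun_prop
  have hf2 : Measurable fun z : H × B =>
      ∫⁻ a, f (z, a) ∂(κ1.comap Prod.fst measurable_fst z) :=
    Measurable.lintegral_kernel_prod_right hf
  rw [lintegral_map hf (by fun_prop), Measure.lintegral_compProd hf1,
    Measure.lintegral_compProd hf, Measure.lintegral_compProd hf2]
  refine lintegral_congr fun h => ?_
  have hf3 : Measurable fun z : A × B => f ((h, z.2), z.1) := by fun_prop
  rw [Kernel.prod_apply, lintegral_prod_symm _ hf3.aemeasurable]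
  rfl

theorem map_fst_compProd_comap {D E F : Type*} [MeasurableSpace D] [MeasurableSpace E]
    [MeasurableSpace F] (m : Measure D) [IsProbabilityMeasure m] (κ : Kernel E F)
    [IsMarkovKernel κ] {f : D → E} (hf : Measurable f) :
    (m ⊗ₘ κ.comap f hf).map (fun z => (f z.1, z.2)) = m.map f ⊗ₘ κ := by
  have := Measure.isProbabilityMeasure_map (μ := m) hf.aemeasurable
  refine Measure.ext_of_lintegral _ fun g hg => ?_
  have hg1 : Measurable fun z : D × F => g (f z.1, z.2) := by fun_prop
  have hg2 : Measurable fun e => ∫⁻ x, g (e, x) ∂(κ e) :=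
    Measurable.lintegral_kernel_prod_right hg
  rw [lintegral_map hg (by fun_prop), Measure.lintegral_compProd hg1,
    Measure.lintegral_compProd hg, lintegral_map hg2 hf]
  rfl

end Swap

section Induces

variable {X A1 A2 : Type*} [MeasurableSpace X] [MeasurableSpace A1] [MeasurableSpace A2]
  {q : Kernel (X × A1 × A2) X} {Acts1 : X → Set A1} {Acts2 : X → Set A2}
  {π1 : Policy1 Acts1} {π2 : Policy2 A1 Acts2} {p0 : Measure X} {p : Measure (TrajM X A1 A2)}

theorem InducesM.map_histProj_eq (hp : InducesM q π1 π2 p0 p) {n : ℕ}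
    {m : Measure (HistM X A1 A2 n)} (hm : Represents p0 q π1.μ π2.μ n m) :
    p.map (histProj n) = m := by
  ext B hB
  rw [Measure.map_apply (measurable_histProj n) hB]
  refine (hp n B hB).trans ?_
  rw [hm _ (measurable_const.indicator hB).aemeasurable, lintegral_indicator hB]
  simp

theorem map_histProj_succ (n : ℕ) :
    p.map (histProj (n + 1))
      = (p.map fun ω => ((histProj n ω, (ω n).2), (ω (n + 1)).1)).map histSnoc := by
  have := measurable_histProj n (X := X) (A1 := A1) (A2 := A2)
  rw [Measure.map_map measurable_histSnoc (by fun_prop)]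
  exact congrArg (Measure.map · p) (funext fun ω => histProj_succ n ω)

/-- The transition law of the states under `p` is `q`. -/
def TransitionLaw (q : Kernel (X × A1 × A2) X) (p : Measure (TrajM X A1 A2)) (n : ℕ) : Prop :=
  p.map (fun ω => ((histProj n ω, (ω n).2), (ω (n + 1)).1))
    = p.map (fun ω => (histProj n ω, (ω n).2)) ⊗ₘ stepKernel q n

/-- Given the history, the actions at time `n` are conditionally independent with laws `κ1` (a
function of the information vector) and `κ2`. -/
def ActionLaw (p : Measure (TrajM X A1 A2)) (n : ℕ) (κ1 : Kernel (InfoM X A1 n) A1)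
    (κ2 : Kernel (HistM X A1 A2 n) A2) : Prop :=
  p.map (fun ω => (histProj n ω, (ω n).2)) = p.map (histProj n) ⊗ₘ actKernel κ1 κ2

theorem InducesM.step [IsMarkovKernel q] [IsProbabilityMeasure p] (hp : InducesM q π1 π2 p0 p)
    {n : ℕ} (hn : Represents p0 q π1.μ π2.μ n (p.map (histProj n)))
    (κ1 : Kernel (InfoM X A1 n) A1) (κ2 : Kernel (HistM X A1 A2 n) A2)
    [IsMarkovKernel κ1] [IsMarkovKernel κ2]
    (h1 : ∀ᵐ i ∂p.map (iProjM n), κ1 i = π1.μ n i)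
    (h2 : ∀ᵐ h ∂p.map (histProj n), κ2 h = π2.μ n h) :
    ActionLaw p n κ1 κ2 ∧ TransitionLaw q p n ∧
      Represents p0 q π1.μ π2.μ (n + 1) (p.map (histProj (n + 1))) := by
  have hmH := measurable_histProj n (X := X) (A1 := A1) (A2 := A2)
  have : IsProbabilityMeasure (p.map (histProj n)) :=
    Measure.isProbabilityMeasure_map hmH.aemeasurable
  have h1' : ∀ᵐ h ∂p.map (histProj n), κ1 (infoM h) = π1.μ n (infoM h) := by
    refine ae_of_ae_map (f := infoM) measurable_infoM.aemeasurable (p := fun i => κ1 i = π1.μ n i) ?_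
    rwa [Measure.map_map measurable_infoM hmH]
  have hR := hn.succ κ1 κ2 h1' h2
  have hmap := hp.map_histProj_eq hR
  have hJ : p.map (fun ω => ((histProj n ω, (ω n).2), (ω (n + 1)).1))
      = (p.map (histProj n) ⊗ₘ actKernel κ1 κ2) ⊗ₘ stepKernel q n := by
    rw [map_histProj_succ] at hmap
    have := congrArg (Measure.map histInit) hmap
    rw [Measure.map_map measurable_histInit measurable_histSnoc,
      Measure.map_map measurable_histInit measurable_histSnoc,
      show histInit ∘ histSnoc = id from funext histInit_histSnoc, Measure.map_id,
      Measure.map_id] at this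
    exact this
  have hA : ActionLaw p n κ1 κ2 := by
    have := congrArg Measure.fst hJ
    rw [Measure.fst_compProd, Measure.fst, Measure.map_map measurable_fst (by fun_prop)] at this
    exact this
  refine ⟨hA, ?_, hmap ▸ hR⟩
  rw [TransitionLaw, hJ, hA]

theorem InducesM.map_zero (hp : InducesM q π1 π2 p0 p) : p.map (fun ω => (ω 0).1) = p0 := by
  have h := congrArg (Measure.map Prod.snd) (hp.map_histProj_eq represents_zero)
  rw [Measure.map_map measurable_snd (measurable_histProj 0),
    Measure.map_map measurable_snd (by fun_prop)] at h
  refine Eq.trans h ?_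
  exact Measure.map_id

theorem InducesM.of_laws [IsMarkovKernel q] [IsProbabilityMeasure p]
    (h0 : p.map (fun ω => (ω 0).1) = p0) (htr : ∀ n, TransitionLaw q p n)
    (hact : ∀ n, ∃ (κ1 : Kernel (InfoM X A1 n) A1) (κ2 : Kernel (HistM X A1 A2 n) A2),
      IsMarkovKernel κ1 ∧ IsMarkovKernel κ2 ∧ (∀ᵐ i ∂p.map (iProjM n), κ1 i = π1.μ n i) ∧
      (∀ᵐ h ∂p.map (histProj n), κ2 h = π2.μ n h) ∧ ActionLaw p n κ1 κ2) :
    InducesM q π1 π2 p0 p := by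
  have hR : ∀ n, Represents p0 q π1.μ π2.μ n (p.map (histProj n)) := by
    intro n
    induction n with
    | zero =>
      have : p.map (histProj 0) = p0.map fun x => (Fin.elim0, x) := by
        rw [← h0, Measure.map_map (by fun_prop) (by fun_prop)]
        refine congrArg (Measure.map · p) (funext fun ω => Prod.ext ?_ rfl)
        exact Subsingleton.elim _ _
      rw [this]; exact represents_zero
    | succ n ih =>
      have hmH := measurable_histProj n (X := X) (A1 := A1) (A2 := A2)
      have := Measure.isProbabilityMeasure_map (μ := p) hmH.aemeasurable
      obtain ⟨κ1, κ2, _, _, h1, h2, hA⟩ := hact n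
      have h1' : ∀ᵐ h ∂p.map (histProj n), κ1 (infoM h) = π1.μ n (infoM h) := by
        refine ae_of_ae_map (f := infoM) measurable_infoM.aemeasurable
          (p := fun i => κ1 i = π1.μ n i) ?_
        rwa [Measure.map_map measurable_infoM hmH]
      have := ih.succ κ1 κ2 h1' h2
      rwa [← hA, ← htr n, ← map_histProj_succ] at this
  intro n B hB
  rw [hR n _ (measurable_const.indicator hB).aemeasurable, lintegral_indicator hB]
  simp only [lintegral_const, Measure.restrict_apply, MeasurableSet.univ, Set.univ_inter, one_mul]
  rw [Measure.map_apply (measurable_histProj n) hB]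
  rfl

variable [MeasurableSpace.CountablyGenerated A1] [MeasurableSpace.CountablyGenerated A2]

theorem InducesM.represents [IsMarkovKernel q] [IsProbabilityMeasure p]
    (hp : InducesM q π1 π2 p0 p) (n : ℕ) :
    Represents p0 q π1.μ π2.μ n (p.map (histProj n)) := by
  obtain ⟨ω⟩ := nonempty_of_isProbabilityMeasure p
  have : Nonempty A1 := ⟨(ω 0).2.1⟩
  have : Nonempty A2 := ⟨(ω 0).2.2⟩
  induction n with
  | zero => rw [hp.map_histProj_eq represents_zero]; exact represents_zero
  | succ n ih =>
    have := Measure.isProbabilityMeasure_map (μ := p) (measurable_histProj n).aemeasurable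
    have := Measure.isProbabilityMeasure_map (μ := p) (measurable_iProjM n).aemeasurable
    obtain ⟨κ1, _, h1⟩ := exists_markovKernel_ae_eq (π1.isProb n) (π1.umeas n) (p.map (iProjM n))
    obtain ⟨κ2, _, h2⟩ := exists_markovKernel_ae_eq (π2.isProb n) (π2.umeas n) (p.map (histProj n))
    exact (hp.step ih κ1 κ2 h1 h2).2.2

theorem InducesM.laws [IsMarkovKernel q] [IsProbabilityMeasure p]
    (hp : InducesM q π1 π2 p0 p) (n : ℕ)
    (κ1 : Kernel (InfoM X A1 n) A1) (κ2 : Kernel (HistM X A1 A2 n) A2)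
    [IsMarkovKernel κ1] [IsMarkovKernel κ2]
    (h1 : ∀ᵐ i ∂p.map (iProjM n), κ1 i = π1.μ n i)
    (h2 : ∀ᵐ h ∂p.map (histProj n), κ2 h = π2.μ n h) :
    ActionLaw p n κ1 κ2 ∧ TransitionLaw q p n :=
  have h := hp.step (hp.represents n) κ1 κ2 h1 h2
  ⟨h.1, h.2.1⟩

end Induces

end PaperStmt

namespace PaperStmt

section ControlLaw

variable {X A1 A2 : Type*} [MeasurableSpace X] [MeasurableSpace A1] [MeasurableSpace A2]
  {p : Measure (TrajM X A1 A2)} {n : ℕ}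

/-- Given the history and the action of the opponent at time `n`, the action of the controller has
law `κ1`, a function of the information vector. -/
def ControlLaw (p : Measure (TrajM X A1 A2)) (n : ℕ) (κ1 : Kernel (InfoM X A1 n) A1) : Prop :=
  p.map (fun ω => ((histProj n ω, (ω n).2.2), (ω n).2.1))
    = p.map (fun ω => (histProj n ω, (ω n).2.2)) ⊗ₘ
      κ1.comap (fun z => infoM z.1) (measurable_infoM.comp measurable_fst)

/-- Given the history, the action of the opponent at time `n` has law `κ2`. -/
def OpponentLaw (p : Measure (TrajM X A1 A2)) (n : ℕ) (κ2 : Kernel (HistM X A1 A2 n) A2) : Prop :=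
  p.map (fun ω => (histProj n ω, (ω n).2.2)) = p.map (histProj n) ⊗ₘ κ2

theorem actionLaw_iff [IsProbabilityMeasure p] (κ1 : Kernel (InfoM X A1 n) A1)
    (κ2 : Kernel (HistM X A1 A2 n) A2) [IsMarkovKernel κ1] [IsMarkovKernel κ2] :
    ActionLaw p n κ1 κ2 ↔ OpponentLaw p n κ2 ∧ ControlLaw p n κ1 := by
  have hm := measurable_histProj n (X := X) (A1 := A1) (A2 := A2)
  have := Measure.isProbabilityMeasure_map (μ := p) hm.aemeasurable
  have hsw := compProd_prod_map_swap (p.map (histProj n)) (κ1.comap infoM measurable_infoM) κ2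
  have hsw' : (p.map (histProj n) ⊗ₘ actKernel κ1 κ2).map (fun z => ((z.1, z.2.2), z.2.1))
      = (p.map (histProj n) ⊗ₘ κ2) ⊗ₘ
        κ1.comap (fun z => infoM z.1) (measurable_infoM.comp measurable_fst) := hsw
  have hmm : (p.map (fun ω => (histProj n ω, (ω n).2))).map (fun z => ((z.1, z.2.2), z.2.1))
      = p.map (fun ω => ((histProj n ω, (ω n).2.2), (ω n).2.1)) := by
    rw [Measure.map_map (by fun_prop) (by fun_prop)]
    rfl
  constructor
  · intro h
    rw [ActionLaw] at h
    rw [h, hsw'] at hmm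
    have hO : OpponentLaw p n κ2 := by
      have := congrArg Measure.fst hmm
      rw [Measure.fst_compProd, Measure.fst, Measure.map_map measurable_fst (by fun_prop)] at this
      exact this.symm
    refine ⟨hO, ?_⟩
    rw [ControlLaw, ← hmm, hO]
  · rintro ⟨hO, hC⟩
    rw [ControlLaw, hO, ← hsw', ← hmm] at hC
    have hinv : Measurable fun z : (HistM X A1 A2 n × A2) × A1 => (z.1.1, z.2, z.1.2) := by
      fun_prop
    have := congrArg (Measure.map fun z : (HistM X A1 A2 n × A2) × A1 => (z.1.1, z.2, z.1.2)) hC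
    rw [Measure.map_map hinv (by fun_prop), Measure.map_map hinv (by fun_prop)] at this
    have hid : (fun z : (HistM X A1 A2 n × A2) × A1 => (z.1.1, z.2, z.1.2)) ∘
        (fun z : HistM X A1 A2 n × A1 × A2 => ((z.1, z.2.2), z.2.1)) = id := rfl
    rw [hid, Measure.map_id, Measure.map_id] at this
    exact this

theorem ControlLaw.map_info [IsProbabilityMeasure p] {κ1 : Kernel (InfoM X A1 n) A1}
    [IsMarkovKernel κ1] (h : ControlLaw p n κ1) :
    p.map (fun ω => (iProjM n ω, (ω n).2.1)) = p.map (iProjM n) ⊗ₘ κ1 := by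
  have hm := measurable_histProj n (X := X) (A1 := A1) (A2 := A2)
  have hmi := measurable_infoM (n := n) (X := X) (A1 := A1) (A2 := A2)
  have := Measure.isProbabilityMeasure_map (μ := p)
    (f := fun ω => (histProj n ω, (ω n).2.2)) (by fun_prop)
  have h' := congrArg (Measure.map fun z : (HistM X A1 A2 n × A2) × A1 => (infoM z.1.1, z.2)) h
  rw [map_fst_compProd_comap _ κ1 (f := fun z : HistM X A1 A2 n × A2 => infoM z.1) (hmi.comp measurable_fst),
    Measure.map_map (by fun_prop) (by fun_prop), Measure.map_map (by fun_prop) (by fun_prop)] at h'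
  exact h'

theorem ControlLaw.congr [IsProbabilityMeasure p] {κ1 κ1' : Kernel (InfoM X A1 n) A1}
    [IsMarkovKernel κ1] [IsMarkovKernel κ1'] (h : ControlLaw p n κ1)
    (hae : ∀ᵐ i ∂p.map (iProjM n), κ1 i = κ1' i) : ControlLaw p n κ1' := by
  have hm := measurable_histProj n (X := X) (A1 := A1) (A2 := A2)
  have hmi := measurable_infoM (n := n) (X := X) (A1 := A1) (A2 := A2)
  rw [ControlLaw, h]
  refine Measure.compProd_congr ?_
  have hmap : (p.map fun ω => (histProj n ω, (ω n).2.2)).map (fun z => infoM z.1)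
      = p.map (iProjM n) := by
    rw [Measure.map_map (by fun_prop) (by fun_prop)]
    rfl
  rw [← hmap] at hae
  exact ae_of_ae_map (by fun_prop) hae

end ControlLaw

section Feasible

variable {X A1 A2 : Type*} [MeasurableSpace X] [MeasurableSpace A1] [MeasurableSpace A2]
  {p : Measure (TrajM X A1 A2)} {n : ℕ}

theorem feasible_iff {I A : Type*} [MeasurableSpace I] [MeasurableSpace A] [IsProbabilityMeasure p]
    {Acts : X → Set A} (hΓ : UniversallyMeasurableSet {xa : X × A | xa.2 ∈ Acts xa.1})
    {f : TrajM X A1 A2 → I} (hf : Measurable f) {g : I → X} (hg : Measurable g)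
    {a : TrajM X A1 A2 → A} (ha : Measurable a) (hgf : ∀ ω, g (f ω) = (ω n).1)
    (κ : Kernel I A) [IsMarkovKernel κ] (hlaw : p.map (fun ω => (f ω, a ω)) = p.map f ⊗ₘ κ) :
    p {ω | a ω ∈ Acts (ω n).1} = 1 ↔ ∀ᵐ i ∂p.map f, κ i (Acts (g i)) = 1 := by
  have := Measure.isProbabilityMeasure_map (μ := p) hf.aemeasurable
  have hfa : Measurable fun ω => (f ω, a ω) := hf.prodMk ha
  have hS : UniversallyMeasurableSet {z : I × A | z.2 ∈ Acts (g z.1)} :=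
    hΓ.preimage (f := fun z : I × A => (g z.1, z.2)) (by fun_prop)
  have h1 := hS.compProd_eq_one_iff (p.map f) κ
  rw [← hlaw, Measure.map_apply₀ hfa.aemeasurable
    (hS _ (Measure.isProbabilityMeasure_map hfa.aemeasurable))] at h1
  simpa [hgf] using h1

theorem exists_feasible_modification {I A : Type*} [MeasurableSpace I] [MeasurableSpace A]
    {Acts : I → Set A} (hΓ : UniversallyMeasurableSet {z : I × A | z.2 ∈ Acts z.1})
    (κ : Kernel I A) [IsMarkovKernel κ] {π : I → Measure A} (hp : ∀ i, IsProbabilityMeasure (π i))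
    (hu : ∀ B, MeasurableSet B → UniversallyMeasurable fun i => π i B)
    (hf : ∀ i, π i (Acts i) = 1) :
    ∃ π' : I → Measure A, (∀ i, IsProbabilityMeasure (π' i)) ∧
      (∀ B, MeasurableSet B → UniversallyMeasurable fun i => π' i B) ∧
      (∀ i, π' i (Acts i) = 1) ∧ ∀ i, κ i (Acts i) = 1 → κ i = π' i := by
  classical
  have hS : UniversallyMeasurableSet {i | κ i (Acts i) = 1} := hΓ.setOf_section_eq_one κ
  refine ⟨fun i => if i ∈ {i | κ i (Acts i) = 1} then κ i else π i, fun i => ?_, fun B hB => ?_,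
    fun i => ?_, fun i hi => ?_⟩
  · dsimp only
    split_ifs
    · infer_instance
    · exact hp i
  · have := universallyMeasurable_ite hS
      (universallyMeasurable_of_measurable (κ.measurable_coe hB)) (hu B hB)
    refine (congrArg UniversallyMeasurable (funext fun i => ?_)).mp this
    dsimp only
    split_ifs <;> rfl
  · dsimp only
    split_ifs with h
    · exact h
    · exact hf i
  · exact (if_pos hi).symm

end Feasible

section Characterization

variable {X A1 A2 : Type*} [MeasurableSpace X] [MeasurableSpace A1] [MeasurableSpace A2]
  [StandardBorelSpace A2]
  {q : Kernel (X × A1 × A2) X} [IsMarkovKernel q] {Acts1 : X → Set A1} {Acts2 : X → Set A2}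
  {p : Measure (TrajM X A1 A2)} [IsProbabilityMeasure p]

/-- The kernels `κ` are conditional distributions of the controller's actions. -/
def IsControlDistrib (p : Measure (TrajM X A1 A2)) (κ : ∀ n, Kernel (InfoM X A1 n) A1) : Prop :=
  ∀ n, p.map (fun ω => (iProjM n ω, (ω n).2.1)) = p.map (iProjM n) ⊗ₘ κ n

/-- Intrinsic conditions characterizing the strategic measures. -/
structure IsStrategic (q : Kernel (X × A1 × A2) X) (Acts1 : X → Set A1) (Acts2 : X → Set A2)
    (p : Measure (TrajM X A1 A2)) (κ : ∀ n, Kernel (InfoM X A1 n) A1) : Prop where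
  transition : ∀ n, TransitionLaw q p n
  control : ∀ n, ControlLaw p n (κ n)
  feasible1 : ∀ n, p {ω | (ω n).2.1 ∈ Acts1 (ω n).1} = 1
  feasible2 : ∀ n, p {ω | (ω n).2.2 ∈ Acts2 (ω n).1} = 1

theorem IsStrategic.exists_inducesM
    (hΓ1 : UniversallyMeasurableSet {xa : X × A1 | xa.2 ∈ Acts1 xa.1})
    (hΓ2 : UniversallyMeasurableSet {xa : X × A2 | xa.2 ∈ Acts2 xa.1})
    (π1' : Policy1 Acts1) (π2' : Policy2 A1 Acts2)
    {κ : ∀ n, Kernel (InfoM X A1 n) A1} [∀ n, IsMarkovKernel (κ n)]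
    (hp : IsStrategic q Acts1 Acts2 p κ) {p0 : Measure X} (h0 : p.map (fun ω => (ω 0).1) = p0) :
    ∃ (π1 : Policy1 Acts1) (π2 : Policy2 A1 Acts2), InducesM q π1 π2 p0 p := by
  obtain ⟨ω⟩ := nonempty_of_isProbabilityMeasure p
  have : Nonempty A2 := ⟨(ω 0).2.2⟩
  have hκ : IsControlDistrib p κ := fun n => (hp.control n).map_info
  let κ2 : ∀ n, Kernel (HistM X A1 A2 n) A2 := fun n =>
    (p.map fun ω => (histProj n ω, (ω n).2.2)).condKernel
  have hmH := fun n => measurable_histProj n (X := X) (A1 := A1) (A2 := A2)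
  have hpr : ∀ n, IsProbabilityMeasure (p.map fun ω => (histProj n ω, (ω n).2.2)) := fun n =>
    Measure.isProbabilityMeasure_map (((hmH n).prodMk (by fun_prop)).aemeasurable)
  have hO : ∀ n, OpponentLaw p n (κ2 n) := fun n => by
    have hfst : (p.map fun ω => (histProj n ω, (ω n).2.2)).fst = p.map (histProj n) := by
      rw [Measure.fst, Measure.map_map measurable_fst ((hmH n).prodMk (by fun_prop))]
      rfl
    rw [OpponentLaw, ← hfst]
    exact (Measure.disintegrate _ _).symm
  have hM2 : ∀ n, IsMarkovKernel (κ2 n) := fun n => inferInstance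
  have hS1 : ∀ n, UniversallyMeasurableSet {z : InfoM X A1 n × A1 | z.2 ∈ Acts1 z.1.2} := fun n =>
    hΓ1.preimage (f := fun z : InfoM X A1 n × A1 => (z.1.2, z.2)) (by fun_prop)
  have hS2 : ∀ n, UniversallyMeasurableSet {z : HistM X A1 A2 n × A2 | z.2 ∈ Acts2 z.1.2} :=
    fun n => hΓ2.preimage (f := fun z : HistM X A1 A2 n × A2 => (z.1.2, z.2)) (by fun_prop)
  choose μ1 hp1 hu1 hf1 he1 using fun n => exists_feasible_modification
    (Acts := fun i => Acts1 i.2) (hS1 n) (κ n) (π1'.isProb n) (π1'.umeas n) (π1'.feasible n)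
  choose μ2 hp2 hu2 hf2 he2 using fun n => exists_feasible_modification
    (Acts := fun i => Acts2 i.2) (hS2 n) (κ2 n) (π2'.isProb n) (π2'.umeas n) (π2'.feasible n)
  refine ⟨⟨μ1, hp1, hu1, hf1⟩, ⟨μ2, hp2, hu2, hf2⟩, InducesM.of_laws h0 hp.transition fun n =>
    ⟨κ n, κ2 n, inferInstance, hM2 n, ?_, ?_, (actionLaw_iff _ _).2 ⟨hO n, hp.control n⟩⟩⟩
  · filter_upwards [(feasible_iff hΓ1 (measurable_iProjM n) measurable_snd (by fun_prop)
      (fun ω => rfl) (κ n) (hκ n)).1 (hp.feasible1 n)] with i hi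
    exact he1 n i hi
  · filter_upwards [(feasible_iff hΓ2 (measurable_histProj n) measurable_snd (by fun_prop)
      (fun ω => rfl) (κ2 n) (hO n)).1 (hp.feasible2 n)] with i hi
    exact he2 n i hi

variable [StandardBorelSpace A1]

theorem InducesM.ae_eq {π1 : Policy1 Acts1} {π2 : Policy2 A1 Acts2} {p0 : Measure X}
    (hp : InducesM q π1 π2 p0 p) {κ : ∀ n, Kernel (InfoM X A1 n) A1} [∀ n, IsMarkovKernel (κ n)]
    (hκ : IsControlDistrib p κ) (n : ℕ) : ∀ᵐ i ∂p.map (iProjM n), κ n i = π1.μ n i := by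
  obtain ⟨ω⟩ := nonempty_of_isProbabilityMeasure p
  have : Nonempty A1 := ⟨(ω 0).2.1⟩
  have : Nonempty A2 := ⟨(ω 0).2.2⟩
  have := Measure.isProbabilityMeasure_map (μ := p) (measurable_histProj n).aemeasurable
  have := Measure.isProbabilityMeasure_map (μ := p) (measurable_iProjM n).aemeasurable
  obtain ⟨κ1, _, h1⟩ := exists_markovKernel_ae_eq (π1.isProb n) (π1.umeas n) (p.map (iProjM n))
  obtain ⟨κ2, _, h2⟩ := exists_markovKernel_ae_eq (π2.isProb n) (π2.umeas n) (p.map (histProj n))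
  have h := ((actionLaw_iff κ1 κ2).1 (hp.laws n κ1 κ2 h1 h2).1).2.map_info
  have := Kernel.ae_eq_of_compProd_eq ((hκ n).symm.trans h)
  filter_upwards [this, h1] with i hi hi'
  rw [hi, hi']

theorem InducesM.exists_opponent_kernel {π1 : Policy1 Acts1} {π2 : Policy2 A1 Acts2}
    {p0 : Measure X} (hp : InducesM q π1 π2 p0 p) {κ : ∀ n, Kernel (InfoM X A1 n) A1}
    [∀ n, IsMarkovKernel (κ n)] (hκ : IsControlDistrib p κ) (n : ℕ) :
    ∃ κ2 : Kernel (HistM X A1 A2 n) A2, IsMarkovKernel κ2 ∧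
      (∀ᵐ h ∂p.map (histProj n), κ2 h = π2.μ n h) ∧ ActionLaw p n (κ n) κ2 ∧
      TransitionLaw q p n := by
  obtain ⟨ω⟩ := nonempty_of_isProbabilityMeasure p
  have : Nonempty A2 := ⟨(ω 0).2.2⟩
  have := Measure.isProbabilityMeasure_map (μ := p) (measurable_histProj n).aemeasurable
  obtain ⟨κ2, _, h2⟩ := exists_markovKernel_ae_eq (π2.isProb n) (π2.umeas n) (p.map (histProj n))
  have := hp.laws n (κ n) κ2 (hp.ae_eq hκ n) h2
  exact ⟨κ2, inferInstance, h2, this.1, this.2⟩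

theorem InducesM.isStrategic
    (hΓ1 : UniversallyMeasurableSet {xa : X × A1 | xa.2 ∈ Acts1 xa.1})
    (hΓ2 : UniversallyMeasurableSet {xa : X × A2 | xa.2 ∈ Acts2 xa.1})
    {π1 : Policy1 Acts1} {π2 : Policy2 A1 Acts2} {p0 : Measure X}
    (hp : InducesM q π1 π2 p0 p) {κ : ∀ n, Kernel (InfoM X A1 n) A1} [∀ n, IsMarkovKernel (κ n)]
    (hκ : IsControlDistrib p κ) : IsStrategic q Acts1 Acts2 p κ := by
  refine ⟨fun n => ?_, fun n => ?_, fun n => ?_, fun n => ?_⟩ <;>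
    obtain ⟨κ2, _, h2, hA, hT⟩ := hp.exists_opponent_kernel hκ n
  · exact hT
  · exact ((actionLaw_iff (κ n) κ2).1 hA).2
  · refine (feasible_iff hΓ1 (measurable_iProjM n) measurable_snd (by fun_prop) (fun ω => rfl)
      (κ n) (hκ n)).2 ?_
    filter_upwards [hp.ae_eq hκ n] with i hi
    rw [hi]; exact π1.feasible n i
  · refine (feasible_iff hΓ2 (measurable_histProj n) measurable_snd (by fun_prop) (fun ω => rfl)
      κ2 ((actionLaw_iff (κ n) κ2).1 hA).1).2 ?_
    filter_upwards [h2] with h hh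
    rw [hh]; exact π2.feasible n h

/-- A strategic measure is also induced by any controller policy that is a version of the
conditional distributions of the controller's actions. -/
theorem InducesM.congr_policy1 {π1 π1' : Policy1 Acts1} {π2 : Policy2 A1 Acts2} {p0 : Measure X}
    (hp : InducesM q π1 π2 p0 p) {κ : ∀ n, Kernel (InfoM X A1 n) A1} [∀ n, IsMarkovKernel (κ n)]
    (hκ : IsControlDistrib p κ) (hae : ∀ n, ∀ᵐ i ∂p.map (iProjM n), κ n i = π1'.μ n i) :
    InducesM q π1' π2 p0 p := by
  choose κ2 hM h2 hA hT using hp.exists_opponent_kernel hκ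
  exact InducesM.of_laws hp.map_zero hT fun n =>
    ⟨κ n, κ2 n, inferInstance, hM n, hae n, h2 n, hA n⟩

end Characterization

end PaperStmt

namespace PaperStmt

theorem measurable_compProd {T D E : Type*} [MeasurableSpace T] [MeasurableSpace D]
    [MeasurableSpace E] {F : T → Measure D} (hF : Measurable F)
    (hFp : ∀ t, IsProbabilityMeasure (F t)) (κ : Kernel (T × D) E) [IsMarkovKernel κ]
    (K : T → Kernel D E) (hK : ∀ t d, K t d = κ (t, d)) : Measurable fun t => F t ⊗ₘ K t := by
  have hM : ∀ t, IsMarkovKernel (K t) := fun t => ⟨fun d => by rw [hK]; infer_instance⟩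
  let f : Kernel T D := ⟨F, hF⟩
  have hf : IsMarkovKernel f := ⟨hFp⟩
  refine Measure.measurable_of_measurable_coe _ fun s hs => ?_
  have hs' : MeasurableSet {z : (T × D) × E | (z.1.2, z.2) ∈ s} :=
    (show Measurable fun z : (T × D) × E => (z.1.2, z.2) by fun_prop) hs
  have hg : Measurable fun z : T × D => κ z (Prod.mk z.2 ⁻¹' s) :=
    Kernel.measurable_kernel_prodMk_left hs'
  have : (fun t => (F t ⊗ₘ K t) s) = fun t => ∫⁻ d, κ (t, d) (Prod.mk d ⁻¹' s) ∂(f t) := by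
    funext t
    rw [Measure.compProd_apply hs]
    simp only [hK]
    rfl
  rw [this]
  exact Measurable.lintegral_kernel_prod_right hg

section Model

variable {X A1 A2 : Type*}
  [TopologicalSpace X] [PolishSpace X] [MeasurableSpace X] [BorelSpace X]
  [TopologicalSpace A1] [PolishSpace A1] [MeasurableSpace A1] [BorelSpace A1]
  [TopologicalSpace A2] [PolishSpace A2] [MeasurableSpace A2] [BorelSpace A2]
  {q : Kernel (X × A1 × A2) X} [IsMarkovKernel q]
  {Acts1 : X → Set A1} {Acts2 : X → Set A2}

theorem measurable_map_probabilityMeasure {Z : Type*} [MeasurableSpace Z]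
    {f : TrajM X A1 A2 → Z} (hf : Measurable f) :
    Measurable fun p : ProbabilityMeasure (TrajM X A1 A2) => p.toMeasure.map f :=
  (Measure.measurable_map f hf).comp measurable_probabilityMeasure_toMeasure

theorem measurableSet_transitionLaw (q : Kernel (X × A1 × A2) X) [IsMarkovKernel q] (n : ℕ) :
    MeasurableSet {p : ProbabilityMeasure (TrajM X A1 A2) | TransitionLaw q p.toMeasure n} := by
  have hm := measurable_histProj n (X := X) (A1 := A1) (A2 := A2)
  have h1 : Measurable fun ω : TrajM X A1 A2 => ((histProj n ω, (ω n).2), (ω (n + 1)).1) := by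
    fun_prop
  have h2 : Measurable fun ω : TrajM X A1 A2 => (histProj n ω, (ω n).2) := by fun_prop
  have hpr : ∀ p : ProbabilityMeasure (TrajM X A1 A2),
      IsProbabilityMeasure (p.toMeasure.map fun ω => (histProj n ω, (ω n).2)) :=
    fun p => Measure.isProbabilityMeasure_map h2.aemeasurable
  refine measurableSet_setOf_measure_eq (measurable_map_probabilityMeasure h1)
    (measurable_compProd (measurable_map_probabilityMeasure h2) hpr
      ((stepKernel q n).comap Prod.snd measurable_snd) (fun _ => stepKernel q n) fun _ _ => rfl)
    (fun p => Measure.isProbabilityMeasure_map h1.aemeasurable) fun p => inferInstance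

/-- The kernel of conditional distributions of the controller's action at time `n`, for a fixed
strategic measure. -/
def infoKernel (ν : ∀ n : ℕ, InfoM X A1 n × ProbabilityMeasure (TrajM X A1 A2) → Measure A1)
    (hν : ∀ n, Measurable (ν n)) (p : ProbabilityMeasure (TrajM X A1 A2)) (n : ℕ) :
    Kernel (InfoM X A1 n) A1 :=
  ⟨fun i => ν n (i, p), (hν n).comp measurable_prodMk_right⟩

variable {ν : ∀ n : ℕ, InfoM X A1 n × ProbabilityMeasure (TrajM X A1 A2) → Measure A1}
  (hν : ∀ n, Measurable (ν n))

theorem isMarkovKernel_infoKernel (hp : ∀ n ip, IsProbabilityMeasure (ν n ip))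
    (p : ProbabilityMeasure (TrajM X A1 A2)) (n : ℕ) : IsMarkovKernel (infoKernel ν hν p n) :=
  ⟨fun i => hp n (i, p)⟩

theorem measurableSet_controlLaw (hp : ∀ n ip, IsProbabilityMeasure (ν n ip)) (n : ℕ) :
    MeasurableSet {p : ProbabilityMeasure (TrajM X A1 A2) |
      ControlLaw p.toMeasure n (infoKernel ν hν p n)} := by
  have hm := measurable_histProj n (X := X) (A1 := A1) (A2 := A2)
  have hmi := measurable_infoM (n := n) (X := X) (A1 := A1) (A2 := A2)
  have h1 : Measurable fun ω : TrajM X A1 A2 => ((histProj n ω, (ω n).2.2), (ω n).2.1) := by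
    fun_prop
  have h2 : Measurable fun ω : TrajM X A1 A2 => (histProj n ω, (ω n).2.2) := by fun_prop
  have hpr : ∀ p : ProbabilityMeasure (TrajM X A1 A2),
      IsProbabilityMeasure (p.toMeasure.map fun ω => (histProj n ω, (ω n).2.2)) :=
    fun p => Measure.isProbabilityMeasure_map h2.aemeasurable
  have hM := isMarkovKernel_infoKernel hν hp
  let κ : Kernel (ProbabilityMeasure (TrajM X A1 A2) × (HistM X A1 A2 n × A2)) A1 :=
    ⟨fun z => ν n (infoM z.2.1, z.1), (hν n).comp (by fun_prop)⟩
  have hκ : IsMarkovKernel κ := ⟨fun z => hp n _⟩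
  refine measurableSet_setOf_measure_eq (measurable_map_probabilityMeasure h1)
    (measurable_compProd (measurable_map_probabilityMeasure h2) hpr κ _ fun _ _ => rfl)
    (fun p => Measure.isProbabilityMeasure_map h1.aemeasurable) fun p => inferInstance

theorem isControlDistrib_infoKernel (hp : ∀ n ip, IsProbabilityMeasure (ν n ip))
    (p : ProbabilityMeasure (TrajM X A1 A2))
    (hνcond : ∀ (n : ℕ) (C : Set (InfoM X A1 n)) (B : Set A1), MeasurableSet C → MeasurableSet B →
        p.toMeasure {ω | iProjM n ω ∈ C ∧ (ω n).2.1 ∈ B}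
          = ∫⁻ i in C, ν n (i, p) B ∂(p.toMeasure.map (iProjM n))) :
    IsControlDistrib p.toMeasure (infoKernel ν hν p) := by
  intro n
  have hm := measurable_iProjM n (X := X) (A1 := A1) (A2 := A2)
  have hM := isMarkovKernel_infoKernel hν hp
  have := Measure.isProbabilityMeasure_map (μ := p.toMeasure) hm.aemeasurable
  have h1 : Measurable fun ω : TrajM X A1 A2 => (iProjM n ω, (ω n).2.1) := by fun_prop
  have := Measure.isProbabilityMeasure_map (μ := p.toMeasure) h1.aemeasurable
  refine Measure.ext_prod fun {C B} hC hB => ?_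
  rw [Measure.compProd_apply_prod hC hB, Measure.map_apply h1 (hC.prod hB)]
  exact hνcond n C B hC hB

theorem measurableSet_infoLaw_eq (hν : ∀ n, Measurable (ν n))
    (hp : ∀ n ip, IsProbabilityMeasure (ν n ip)) (n : ℕ) :
    MeasurableSet {t : ProbabilityMeasure (TrajM X A1 A2) × ProbabilityMeasure (TrajM X A1 A2) |
      t.2.toMeasure {ω | ν n (iProjM n ω, t.2) = ν n (iProjM n ω, t.1)} = 1} := by
  have hm := measurable_iProjM n (X := X) (A1 := A1) (A2 := A2)
  have hD : MeasurableSet {z : (ProbabilityMeasure (TrajM X A1 A2) ×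
      ProbabilityMeasure (TrajM X A1 A2)) × TrajM X A1 A2 |
      ν n (iProjM n z.2, z.1.2) = ν n (iProjM n z.2, z.1.1)} :=
    measurableSet_setOf_measure_eq ((hν n).comp (by fun_prop)) ((hν n).comp (by fun_prop))
      (fun _ => hp n _) fun _ => hp n _
  exact Kernel.measurable_kernel_prodMk_left
    (κ := (probKernel (TrajM X A1 A2)).comap Prod.snd measurable_snd) hD
    (measurableSet_singleton 1)

theorem measurableSet_info_absolutelyContinuous (n : ℕ) :
    MeasurableSet {t : ProbabilityMeasure (TrajM X A1 A2) × ProbabilityMeasure (TrajM X A1 A2) |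
      t.2.toMeasure.map (iProjM n) ≪ t.1.toMeasure.map (iProjM n)} := by
  have hm := measurable_iProjM n (X := X) (A1 := A1) (A2 := A2)
  have h := Kernel.measurableSet_absolutelyContinuous
    (((probKernel (TrajM X A1 A2)).map (iProjM n)).comap
      (Prod.snd : ProbabilityMeasure (TrajM X A1 A2) × ProbabilityMeasure (TrajM X A1 A2) → _)
      measurable_snd)
    (((probKernel (TrajM X A1 A2)).map (iProjM n)).comap
      (Prod.fst : ProbabilityMeasure (TrajM X A1 A2) × ProbabilityMeasure (TrajM X A1 A2) → _)
      measurable_fst)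
  simpa only [Kernel.comap_apply, Kernel.map_apply _ hm, probKernel_apply] using h

theorem measurableSet_initial :
    MeasurableSet {t : X × ProbabilityMeasure (TrajM X A1 A2) |
      t.2.toMeasure.map (fun ω => (ω 0).1) = Measure.dirac t.1} := by
  have h0 : Measurable fun ω : TrajM X A1 A2 => (ω 0).1 := by fun_prop
  exact measurableSet_setOf_measure_eq ((measurable_map_probabilityMeasure h0).comp measurable_snd)
    (Measure.measurable_dirac.comp measurable_fst)
    (fun p => Measure.isProbabilityMeasure_map h0.aemeasurable) fun p => inferInstance

/-- The part of the characterization of the strategic measures that does not involve the control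
constraints. -/
def IsUnconstrained (q : Kernel (X × A1 × A2) X)
    (ν : ∀ n : ℕ, InfoM X A1 n × ProbabilityMeasure (TrajM X A1 A2) → Measure A1)
    (hν : ∀ n, Measurable (ν n)) (t : X × ProbabilityMeasure (TrajM X A1 A2)) : Prop :=
  t.2.toMeasure.map (fun ω => (ω 0).1) = Measure.dirac t.1 ∧
    ∀ n, TransitionLaw q t.2.toMeasure n ∧ ControlLaw t.2.toMeasure n (infoKernel ν hν t.2 n)

theorem measurableSet_isUnconstrained (hp : ∀ n ip, IsProbabilityMeasure (ν n ip)) :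
    MeasurableSet {t : X × ProbabilityMeasure (TrajM X A1 A2) | IsUnconstrained q ν hν t} := by
  have h : MeasurableSet {t : X × ProbabilityMeasure (TrajM X A1 A2) |
      ∀ n, TransitionLaw q t.2.toMeasure n ∧
        ControlLaw t.2.toMeasure n (infoKernel ν hν t.2 n)} := by
    rw [Set.ofPred_forall]
    exact MeasurableSet.iInter fun n => (measurable_snd (measurableSet_transitionLaw q n)).inter
      (measurable_snd (measurableSet_controlLaw hν hp n))
  exact measurableSet_initial.inter h

/-- The measures under which both players respect their constraints at time `n`. -/
def feasibleSet (Acts1 : X → Set A1) (Acts2 : X → Set A2) (n : ℕ) :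
    Set (ProbabilityMeasure (TrajM X A1 A2)) :=
  {p | p.toMeasure {ω | (ω n).2.1 ∈ Acts1 (ω n).1} = 1} ∩
    {p | p.toMeasure {ω | (ω n).2.2 ∈ Acts2 (ω n).1} = 1}

theorem analyticSet_inter {Y : Type*} [TopologicalSpace Y] [T2Space Y] {s t : Set Y}
    (hs : AnalyticSet s) (ht : AnalyticSet t) : AnalyticSet (s ∩ t) := by
  rw [Set.inter_eq_iInter]
  exact AnalyticSet.iInter fun b => by cases b <;> assumption

theorem analyticSet_feasibleSet
    (hΓ1 : AnalyticSet {xa : X × A1 | xa.2 ∈ Acts1 xa.1})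
    (hΓ2 : AnalyticSet {xa : X × A2 | xa.2 ∈ Acts2 xa.1}) (n : ℕ) :
    AnalyticSet (feasibleSet Acts1 Acts2 n) := by
  have hΩ := analyticSet_univ_of_polishSpace (TrajM X A1 A2)
  refine analyticSet_inter (analyticSet_setOf_measure_eq_one ?_)
    (analyticSet_setOf_measure_eq_one ?_)
  · exact analyticSet_preimage hΩ (φ := fun ω => ((ω n).1, (ω n).2.1)) (by fun_prop) hΓ1
  · exact analyticSet_preimage hΩ (φ := fun ω => ((ω n).1, (ω n).2.2)) (by fun_prop) hΓ2

theorem measurableSet_feasibleSet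
    (hΓ1 : MeasurableSet {xa : X × A1 | xa.2 ∈ Acts1 xa.1})
    (hΓ2 : MeasurableSet {xa : X × A2 | xa.2 ∈ Acts2 xa.1}) (n : ℕ) :
    MeasurableSet (feasibleSet Acts1 Acts2 n) := by
  have h1 : MeasurableSet {ω : TrajM X A1 A2 | (ω n).2.1 ∈ Acts1 (ω n).1} :=
    (show Measurable fun ω : TrajM X A1 A2 => ((ω n).1, (ω n).2.1) by fun_prop) hΓ1
  have h2 : MeasurableSet {ω : TrajM X A1 A2 | (ω n).2.2 ∈ Acts2 (ω n).1} :=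
    (show Measurable fun ω : TrajM X A1 A2 => ((ω n).1, (ω n).2.2) by fun_prop) hΓ2
  exact ((Measure.measurable_coe h1).comp measurable_probabilityMeasure_toMeasure
    (measurableSet_singleton 1)).inter
    ((Measure.measurable_coe h2).comp measurable_probabilityMeasure_toMeasure
    (measurableSet_singleton 1))

theorem mem_tsetM_iff
    (hΓ1 : AnalyticSet {xa : X × A1 | xa.2 ∈ Acts1 xa.1})
    (hΓ2 : AnalyticSet {xa : X × A2 | xa.2 ∈ Acts2 xa.1})
    (π1 : Policy1 Acts1) (π2 : Policy2 A1 Acts2)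
    (hp : ∀ n ip, IsProbabilityMeasure (ν n ip))
    (hκ : ∀ p : ProbabilityMeasure (TrajM X A1 A2),
      IsControlDistrib p.toMeasure (infoKernel ν hν p))
    (t : X × ProbabilityMeasure (TrajM X A1 A2)) :
    t ∈ tsetM q Acts1 Acts2 ↔
      IsUnconstrained q ν hν t ∧ ∀ n, t.2 ∈ feasibleSet Acts1 Acts2 n := by
  have hM := isMarkovKernel_infoKernel hν hp t.2
  have hU1 := universallyMeasurableSet_of_analyticSet hΓ1
  have hU2 := universallyMeasurableSet_of_analyticSet hΓ2
  constructor
  · rintro ⟨⟨π1, π2, p0, h⟩, h0⟩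
    have hs := h.isStrategic hU1 hU2 (hκ t.2)
    exact ⟨⟨h0, fun n => ⟨hs.transition n, hs.control n⟩⟩,
      fun n => ⟨hs.feasible1 n, hs.feasible2 n⟩⟩
  · rintro ⟨⟨h0, h⟩, hf⟩
    have hs : IsStrategic q Acts1 Acts2 t.2.toMeasure (infoKernel ν hν t.2) :=
      ⟨fun n => (h n).1, fun n => (h n).2, fun n => (hf n).1, fun n => (hf n).2⟩
    obtain ⟨π1', π2', hI⟩ := hs.exists_inducesM hU1 hU2 π1 π2 h0
    exact ⟨⟨π1', π2', ⟨Measure.dirac t.1, inferInstance⟩, hI⟩, h0⟩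

theorem hatSM_eq
    (hΓ1 : AnalyticSet {xa : X × A1 | xa.2 ∈ Acts1 xa.1})
    (hΓ2 : AnalyticSet {xa : X × A2 | xa.2 ∈ Acts2 xa.1})
    (π1 : Policy1 Acts1) (π2 : Policy2 A1 Acts2)
    (hp : ∀ n ip, IsProbabilityMeasure (ν n ip))
    (hκ : ∀ p : ProbabilityMeasure (TrajM X A1 A2),
      IsControlDistrib p.toMeasure (infoKernel ν hν p)) :
    ∃ M, MeasurableSet M ∧ hatSM q Acts1 Acts2 ν = M ∩ ⋂ n,
      ((fun t => t.2.1) ⁻¹' feasibleSet Acts1 Acts2 n ∩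
        (fun t => t.2.2) ⁻¹' feasibleSet Acts1 Acts2 n) := by
  let M : Set (X × ProbabilityMeasure (TrajM X A1 A2) × ProbabilityMeasure (TrajM X A1 A2)) :=
    ((fun t => (t.1, t.2.1)) ⁻¹' {t | IsUnconstrained q ν hν t} ∩
      (fun t => (t.1, t.2.2)) ⁻¹' {t | IsUnconstrained q ν hν t}) ∩
    ((⋂ n, Prod.snd ⁻¹' {t : ProbabilityMeasure (TrajM X A1 A2) ×
        ProbabilityMeasure (TrajM X A1 A2) |
        t.2.toMeasure {ω | ν n (iProjM n ω, t.2) = ν n (iProjM n ω, t.1)} = 1}) ∩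
      ⋂ n, Prod.snd ⁻¹' {t : ProbabilityMeasure (TrajM X A1 A2) ×
        ProbabilityMeasure (TrajM X A1 A2) |
        t.2.toMeasure.map (iProjM n) ≪ t.1.toMeasure.map (iProjM n)})
  have hU := measurableSet_isUnconstrained (q := q) hν hp
  refine ⟨M, ?_, ?_⟩
  · have e1 : Measurable fun t : X × ProbabilityMeasure (TrajM X A1 A2) ×
        ProbabilityMeasure (TrajM X A1 A2) => (t.1, t.2.1) :=
      measurable_fst.prodMk (measurable_fst.comp measurable_snd)
    have e2 : Measurable fun t : X × ProbabilityMeasure (TrajM X A1 A2) ×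
        ProbabilityMeasure (TrajM X A1 A2) => (t.1, t.2.2) :=
      measurable_fst.prodMk (measurable_snd.comp measurable_snd)
    exact ((e1 hU).inter (e2 hU)).inter
      ((MeasurableSet.iInter fun n => measurable_snd (measurableSet_infoLaw_eq hν hp n)).inter
        (MeasurableSet.iInter fun n => measurable_snd (measurableSet_info_absolutelyContinuous n)))
  · ext t
    have h1 := mem_tsetM_iff (q := q) hν hΓ1 hΓ2 π1 π2 hp hκ (t.1, t.2.1)
    have h2 := mem_tsetM_iff (q := q) hν hΓ1 hΓ2 π1 π2 hp hκ (t.1, t.2.2)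
    simp only [hatSM, Set.mem_ofPred_eq, M, Set.mem_inter_iff, Set.mem_iInter, Set.mem_preimage,
      h1, h2, forall_and]
    tauto

theorem analyticSet_of_measurableSet_prod
    {M : Set (X × ProbabilityMeasure (TrajM X A1 A2) × ProbabilityMeasure (TrajM X A1 A2))}
    (hM : MeasurableSet M) : AnalyticSet M := by
  have : BorelSpace (ProbabilityMeasure (TrajM X A1 A2)) := ⟨rfl⟩
  have hP := analyticSet_univ_probabilityMeasure (Ω := TrajM X A1 A2)
  refine analyticSet_of_measurableSet
    (analyticSet_univ_prod (analyticSet_univ_of_polishSpace X) (analyticSet_univ_prod hP hP))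
    (fun f hf => ?_) hM
  exact hf.fst.measurable.prodMk (hf.snd.fst.measurable.prodMk hf.snd.snd.measurable)

theorem analyticSet_hatSM
    (hΓ1 : AnalyticSet {xa : X × A1 | xa.2 ∈ Acts1 xa.1})
    (hΓ2 : AnalyticSet {xa : X × A2 | xa.2 ∈ Acts2 xa.1})
    (π1 : Policy1 Acts1) (π2 : Policy2 A1 Acts2)
    (hp : ∀ n ip, IsProbabilityMeasure (ν n ip))
    (hκ : ∀ p : ProbabilityMeasure (TrajM X A1 A2),
      IsControlDistrib p.toMeasure (infoKernel ν hν p)) :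
    AnalyticSet (hatSM q Acts1 Acts2 ν) := by
  obtain ⟨M, hM, h⟩ := hatSM_eq (q := q) hν hΓ1 hΓ2 π1 π2 hp hκ
  rw [h]
  have hT : AnalyticSet (Set.univ :
      Set (X × ProbabilityMeasure (TrajM X A1 A2) × ProbabilityMeasure (TrajM X A1 A2))) :=
    analyticSet_of_measurableSet_prod MeasurableSet.univ
  have : T2Space (ProbabilityMeasure (TrajM X A1 A2) × ProbabilityMeasure (TrajM X A1 A2)) :=
    Prod.t2Space
  refine analyticSet_inter (analyticSet_of_measurableSet_prod hM) (AnalyticSet.iInter fun n => ?_)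
  have hF := analyticSet_feasibleSet hΓ1 hΓ2 n
  exact analyticSet_inter (analyticSet_preimage hT (by fun_prop) hF)
    (analyticSet_preimage hT (by fun_prop) hF)

theorem measurableSet_hatSM
    (hΓ1 : MeasurableSet {xa : X × A1 | xa.2 ∈ Acts1 xa.1})
    (hΓ2 : MeasurableSet {xa : X × A2 | xa.2 ∈ Acts2 xa.1})
    (π1 : Policy1 Acts1) (π2 : Policy2 A1 Acts2)
    (hp : ∀ n ip, IsProbabilityMeasure (ν n ip))
    (hκ : ∀ p : ProbabilityMeasure (TrajM X A1 A2),
      IsControlDistrib p.toMeasure (infoKernel ν hν p)) :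
    MeasurableSet (hatSM q Acts1 Acts2 ν) := by
  obtain ⟨M, hM, h⟩ := hatSM_eq (q := q) hν hΓ1.analyticSet hΓ2.analyticSet π1 π2 hp hκ
  rw [h]
  refine hM.inter (MeasurableSet.iInter fun n => ?_)
  have hF := measurableSet_feasibleSet hΓ1 hΓ2 n
  exact ((measurable_fst.comp measurable_snd) hF).inter ((measurable_snd.comp measurable_snd) hF)

theorem section_hatSM_eq
    (hp : ∀ n ip, IsProbabilityMeasure (ν n ip))
    (hκ : ∀ p : ProbabilityMeasure (TrajM X A1 A2),
      IsControlDistrib p.toMeasure (infoKernel ν hν p))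
    (hAC : AssumpAC q Acts1 Acts2) {x : X} {π1 : Policy1 Acts1} {π2 : Policy2 A1 Acts2}
    {p : ProbabilityMeasure (TrajM X A1 A2)}
    (h : InducesM q π1 π2 (Measure.dirac x) p.toMeasure) :
    {p' : ProbabilityMeasure (TrajM X A1 A2) | (x, p, p') ∈ hatSM q Acts1 Acts2 ν}
      = {p' | ∃ π2' : Policy2 A1 Acts2, InducesM q π1 π2' (Measure.dirac x) p'.toMeasure} := by
  have hM := isMarkovKernel_infoKernel hν hp
  have hmI := fun n => measurable_iProjM n (X := X) (A1 := A1) (A2 := A2)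
  have hset : ∀ (p' : ProbabilityMeasure (TrajM X A1 A2)) (n : ℕ),
      p'.toMeasure {ω | ν n (iProjM n ω, p') = ν n (iProjM n ω, p)} = 1 ↔
      ∀ᵐ i ∂p'.toMeasure.map (iProjM n), ν n (i, p') = ν n (i, p) := fun p' n => by
    have hD : MeasurableSet {i | ν n (i, p') = ν n (i, p)} :=
      measurableSet_setOf_measure_eq ((hν n).comp measurable_prodMk_right)
        ((hν n).comp measurable_prodMk_right) (fun _ => hp n _) fun _ => hp n _
    rw [ae_map_iff (hmI n).aemeasurable hD]
    exact (mem_ae_iff_prob_eq_one (hmI n hD)).symm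
  ext p'
  constructor
  · rintro ⟨-, ⟨⟨π1', π2', p0, h'⟩, h0⟩, heq, hac⟩
    have hp0 : p0.toMeasure = Measure.dirac x := h'.map_zero.symm.trans h0
    rw [hp0] at h'
    refine ⟨π2', h'.congr_policy1 (hκ p') fun n => ?_⟩
    filter_upwards [(hset p' n).1 (heq n), (hac n).ae_le (h.ae_eq (hκ p) n)] with i hi hi'
    exact hi.trans hi'
  · rintro ⟨π2', h'⟩
    have hac := hAC π1 π2' π2 x p' p h' h
    refine ⟨⟨⟨π1, π2, ⟨Measure.dirac x, inferInstance⟩, h⟩, h.map_zero⟩,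
      ⟨⟨π1, π2', ⟨Measure.dirac x, inferInstance⟩, h'⟩, h'.map_zero⟩, fun n => ?_, hac⟩
    refine (hset p' n).2 ?_
    filter_upwards [h'.ae_eq (hκ p') n, (hac n).ae_le (h.ae_eq (hκ p) n)] with i hi hi'
    exact hi.trans hi'.symm

end Model

end PaperStmt

namespace PaperStmt

variable {X A1 A2 : Type*} [MeasurableSpace X] [MeasurableSpace A1] [MeasurableSpace A2]
  [TopologicalSpace X] [OpensMeasurableSpace X] [TopologicalSpace A1] [OpensMeasurableSpace A1]
  [TopologicalSpace A2] [OpensMeasurableSpace A2]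

/-- Proposition `prp-minmax-strm2`: (i) `Ŝ_M` is analytic, and Borel if
`Γ₁` and `Γ₂` are Borel; (ii) under Assumption AC, if `p = ρ_x[π₁, π₂]`, then the section
`Ŝ_M(x, p)` is exactly the set of strategic measures `ρ_x[π₁, π̃₂]`, `π̃₂ ∈ Π₂`. -/
theorem statement16
    {X A1 A2 : Type*}
    [TopologicalSpace X] [PolishSpace X] [MeasurableSpace X] [BorelSpace X]
    [TopologicalSpace A1] [PolishSpace A1] [MeasurableSpace A1] [BorelSpace A1]
    [TopologicalSpace A2] [PolishSpace A2] [MeasurableSpace A2] [BorelSpace A2]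
    (q : Kernel (X × A1 × A2) X) [IsMarkovKernel q]
    (Acts1 : X → Set A1) (Acts2 : X → Set A2)
    (hne1 : ∀ x, (Acts1 x).Nonempty) (hne2 : ∀ x, (Acts2 x).Nonempty)
    (hΓ1 : MeasureTheory.AnalyticSet {xa : X × A1 | xa.2 ∈ Acts1 xa.1})
    (hΓ2 : MeasureTheory.AnalyticSet {xa : X × A2 | xa.2 ∈ Acts2 xa.1})
    -- a fixed Borel measurable family of conditional distributions of `a¹_n` given `i_n`:
    (ν : ∀ n : ℕ, InfoM X A1 n × ProbabilityMeasure (TrajM X A1 A2) → Measure A1)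
    (hνmeas : ∀ n, Measurable (ν n))
    (hνprob : ∀ n ip, IsProbabilityMeasure (ν n ip))
    (hνcond : ∀ (n : ℕ) (p : ProbabilityMeasure (TrajM X A1 A2))
        (C : Set (InfoM X A1 n)) (B : Set A1), MeasurableSet C → MeasurableSet B →
        p.toMeasure {ω | iProjM n ω ∈ C ∧ (ω n).2.1 ∈ B}
          = ∫⁻ i in C, ν n (i, p) B ∂(p.toMeasure.map (iProjM n))) :
    -- (i)
    (MeasureTheory.AnalyticSet (hatSM q Acts1 Acts2 ν) ∧
     (MeasurableSet {xa : X × A1 | xa.2 ∈ Acts1 xa.1} →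
      MeasurableSet {xa : X × A2 | xa.2 ∈ Acts2 xa.1} →
      MeasurableSet (hatSM q Acts1 Acts2 ν))) ∧
    -- (ii)
    (AssumpAC q Acts1 Acts2 →
      ∀ (x : X) (π1 : Policy1 Acts1) (π2 : Policy2 A1 Acts2)
        (p : ProbabilityMeasure (TrajM X A1 A2)),
        InducesM q π1 π2 (Measure.dirac x) p.toMeasure →
        {p' : ProbabilityMeasure (TrajM X A1 A2) | (x, p, p') ∈ hatSM q Acts1 Acts2 ν}
          = {p' | ∃ π2' : Policy2 A1 Acts2,
              InducesM q π1 π2' (Measure.dirac x) p'.toMeasure}) := by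
  have hκ : ∀ p : ProbabilityMeasure (TrajM X A1 A2),
      IsControlDistrib p.toMeasure (infoKernel ν hνmeas p) := fun p =>
    isControlDistrib_infoKernel hνmeas hνprob p fun n => hνcond n p
  refine ⟨?_, fun hAC x π1 π2 p h => section_hatSM_eq hνmeas hνprob hκ hAC h⟩
  by_cases hpol : Nonempty (Policy1 Acts1) ∧ Nonempty (Policy2 A1 Acts2)
  · obtain ⟨⟨π1⟩, ⟨π2⟩⟩ := hpol
    exact ⟨analyticSet_hatSM hνmeas hΓ1 hΓ2 π1 π2 hνprob hκ,
      fun h1 h2 => measurableSet_hatSM hνmeas h1 h2 π1 π2 hνprob hκ⟩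
  · have : hatSM q Acts1 Acts2 ν = ∅ := by
      rw [Set.eq_empty_iff_forall_notMem]
      rintro t ⟨⟨⟨π1, π2, -⟩, -⟩, -⟩
      exact hpol ⟨⟨π1⟩, ⟨π2⟩⟩
    rw [this]
    exact ⟨analyticSet_empty, fun _ _ => MeasurableSet.empty⟩

end PaperStmt
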